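/- arXiv:1008.2878 — 5 statements merged into one kernel-verified Lean document; each statement's English description precedes it below -/
import Mathlib

section
/- The set of cyclic unitary operators on a separable infinite-dimensional complex Hilbert space H is dense, in the operator-norm topology, in the set of all unitary operators on H. -/
open Filter Topology

namespace CyclicUnitary

/-- A bounded operator that respects an orthogonal decomposition is bounded by its bound on
each piece. -/
lemma norm_le_of_family {H : Type*} [NormedAddCommGroup H] [InnerProductSpace ℂ H]
    {ι : Type*} (M : ι → Submodule ℂ H)
    (hM : OrthogonalFamily ℂ (fun i => M i) (fun i => (M i).subtypeₗᵢ))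
    (hd : (⨆ i, M i).topologicalClosure = ⊤) (W : H →L[ℂ] H) {δ : ℝ} (hδ : 0 ≤ δ)
    (hW : ∀ i, ∀ x ∈ M i, W x ∈ M i ∧ ‖W x‖ ≤ δ * ‖x‖) : ‖W‖ ≤ δ := by
  refine W.opNorm_le_bound hδ fun x => ?_
  have hcl : IsClosed {x : H | ‖W x‖ ≤ δ * ‖x‖} := isClosed_le (by fun_prop) (by fun_prop)
  have hx : x ∈ (⨆ i, M i).topologicalClosure := by rw [hd]; trivial
  refine closure_minimal (s := ((⨆ i, M i : Submodule ℂ H) : Set H)) ?_ hcl hx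
  intro z hz
  obtain ⟨f, hf, rfl⟩ := (Submodule.mem_iSup_iff_exists_finsupp M z).1 hz
  simp only [Set.mem_ofPred_eq, Finsupp.sum, map_sum]
  have h1 := hM.norm_sum (fun i => (⟨f i, hf i⟩ : M i)) f.support
  have h2 := hM.norm_sum (fun i => (⟨W (f i), (hW i _ (hf i)).1⟩ : M i)) f.support
  simp only [Submodule.coe_norm] at h1 h2
  change ‖∑ i ∈ f.support, f i‖ ^ 2 = _ at h1
  change ‖∑ i ∈ f.support, W (f i)‖ ^ 2 = _ at h2
  refine le_of_sq_le_sq ?_ (by positivity)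
  rw [mul_pow, h1, h2, Finset.mul_sum]
  refine Finset.sum_le_sum fun i _ => ?_
  rw [← mul_pow]
  exact pow_le_pow_left₀ (norm_nonneg _) (hW i _ (hf i)).2 2

section
variable {H : Type*} [NormedAddCommGroup H] [InnerProductSpace ℂ H] [CompleteSpace H]

lemma ker_inv {A B : H →L[ℂ] H} (h : Commute A B) {x : H} (hx : B x = 0) : B (A x) = 0 := by
  have := congrArg (fun T : H →L[ℂ] H => T x) h.eq
  simp only [mul_apply_eq_comp, hx, map_zero] at this
  exact this.symm

lemma ker_perp_inv {A B : H →L[ℂ] H} (h : Commute (star A) B) {x : H} (hx : x ∈ B.kerᗮ) :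
    A x ∈ B.kerᗮ := by
  rw [Submodule.mem_orthogonal] at hx ⊢
  intro u hu
  rw [← ContinuousLinearMap.adjoint_inner_left]
  exact hx _ (ker_inv h hu)

/-- Orthogonal decomposition along finitely many commuting self-adjoint operators. -/
lemma decomp {n : ℕ} (F : Fin n → H →L[ℂ] H) (hsa : ∀ i, IsSelfAdjoint (F i))
    (hcomm : ∀ i j, Commute (F i) (F j)) (hker : ∀ x, (∀ i, F i x = 0) → x = 0) :
    ∃ M : Fin n → Submodule ℂ H, (∀ i, IsClosed (M i : Set H)) ∧
      OrthogonalFamily ℂ (fun i => M i) (fun i => (M i).subtypeₗᵢ) ∧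
      (⨆ i, M i).topologicalClosure = ⊤ ∧ (∀ i, M i ≤ (F i).kerᗮ) ∧
      ∀ A : H →L[ℂ] H, (∀ i, Commute A (F i)) → (∀ i, Commute (star A) (F i)) →
        ∀ i, ∀ x ∈ M i, A x ∈ M i := by
  let M : Fin n → Submodule ℂ H := fun j => (⨅ i : {i // i < j}, (F i).ker) ⊓ (F j).kerᗮ
  have hmem : ∀ j x, x ∈ M j ↔ (∀ i, i < j → F i x = 0) ∧ x ∈ (F j).kerᗮ := by
    intro j x
    simp [M, Submodule.mem_iInf]
  have hlt : ∀ i j, i < j → ∀ x ∈ M i, ∀ y ∈ M j, inner ℂ y x = 0 := by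
    intro i j hij x hx y hy
    exact ((hmem i x).1 hx).2 y (((hmem j y).1 hy).1 i hij)
  refine ⟨M, ?_, ?_, ?_, ?_, ?_⟩
  · intro j
    have : (M j : Set H) = (⋂ i : {i // i < j}, ((F i).ker : Set H)) ∩ ((F j).kerᗮ : Set H) := by
      simp [M]
    rw [this]
    refine IsClosed.inter (isClosed_iInter fun i => (F i).isClosed_ker) ?_
    exact Submodule.isClosed_orthogonal _
  · intro i j hij x y
    rcases lt_or_gt_of_ne hij with h | h
    · exact inner_eq_zero_symm.1 (hlt i j h x x.2 y y.2)
    · exact hlt j i h y y.2 x x.2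
  · rw [Submodule.topologicalClosure_eq_top_iff, Submodule.eq_bot_iff]
    intro v hv
    apply hker
    have hv' : ∀ j, ∀ y ∈ M j, inner ℂ y v = 0 := fun j y hy =>
      hv y (Submodule.mem_iSup_of_mem j hy)
    intro j
    induction j using WellFoundedLT.induction with
    | ind j ih =>
    have : CompleteSpace (F j).ker := (F j).isClosed_ker.completeSpace_coe
    obtain ⟨a, ha, b, hb, hab⟩ := (F j).ker.exists_add_mem_mem_orthogonal v
    have hFb : ∀ i, i < j → F i b = 0 := by
      intro i hij
      have h1 : F i a + F i b = 0 := by rw [← map_add, ← hab]; exact ih i hij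
      have h2 : F i a ∈ (F j).ker := ker_inv (hcomm i j) ha
      have h3 : F i b ∈ (F j).kerᗮ := ker_perp_inv (by rw [(hsa i).star_eq]; exact hcomm i j) hb
      have h4 : F i b = - F i a := (neg_eq_of_add_eq_zero_right h1).symm
      have h5 : F i b ∈ (F j).ker := h4 ▸ Submodule.neg_mem _ h2
      exact inner_self_eq_zero.1 (h3 _ h5)
    have h6 : inner ℂ b v = 0 := hv' j b ((hmem j b).2 ⟨hFb, hb⟩)
    rw [hab, inner_add_right, inner_eq_zero_symm.1 (hb a ha), zero_add] at h6
    have hb0 : b = 0 := inner_self_eq_zero.1 h6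
    rw [hab, hb0, add_zero]
    exact ha
  · intro j
    exact inf_le_right
  · intro A h1 h2 j x hx
    rw [hmem] at hx ⊢
    exact ⟨fun i hi => ker_inv (h1 i) (hx.1 i hi), ker_perp_inv (h2 j) hx.2⟩

/-- Approximate spectral decomposition of a unitary. -/
lemma exists_decomp (U : H →L[ℂ] H) (hU : U ∈ unitary (H →L[ℂ] H)) {δ : ℝ} (hδ : 0 < δ) :
    ∃ (n : ℕ) (c : Fin n → ℂ) (M : Fin n → Submodule ℂ H), (∀ i, ‖c i‖ = 1) ∧
      (∀ i, IsClosed (M i : Set H)) ∧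
      OrthogonalFamily ℂ (fun i => M i) (fun i => (M i).subtypeₗᵢ) ∧
      (⨆ i, M i).topologicalClosure = ⊤ ∧
      ∀ i, ∀ x ∈ M i, U x ∈ M i ∧ ‖U x - c i • x‖ ≤ δ * ‖x‖ := by
  have hN : IsStarNormal U := ⟨by
    rw [commute_iff_eq, (Unitary.mem_iff.1 hU).1, (Unitary.mem_iff.1 hU).2]⟩
  obtain ⟨t, ht, htf, htc⟩ := (isCompact_sphere (0 : ℂ) 1).finite_cover_balls hδ
  obtain ⟨n, c, hc⟩ : ∃ (n : ℕ) (c : Fin n → ℂ), Set.range c = t := by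
    have := htf.to_subtype
    obtain ⟨n, ⟨e⟩⟩ := Finite.exists_equiv_fin t
    refine ⟨n, fun i => (e.symm i : ℂ), ?_⟩
    ext z
    constructor
    · rintro ⟨i, rfl⟩; exact (e.symm i).2
    · intro hz; exact ⟨e ⟨z, hz⟩, by simp⟩
  let f : Fin n → ℂ → ℂ := fun i z => ((max 0 (δ - ‖z - c i‖) : ℝ) : ℂ)
  have hf : ∀ i, Continuous (f i) := fun i => by fun_prop
  let g : Fin n → ℂ → ℂ := fun i z => (z - c i) / ((max 1 (‖z - c i‖ / δ) : ℝ) : ℂ)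
  have hden : ∀ i z, ((max 1 (‖z - c i‖ / δ) : ℝ) : ℂ) ≠ 0 := fun i z => by
    exact_mod_cast (lt_of_lt_of_le one_pos (le_max_left _ _)).ne'
  have hg : ∀ i, Continuous (g i) := fun i => by
    refine Continuous.div (by fun_prop) (by fun_prop) (hden i)
  have hsa : ∀ i, IsSelfAdjoint (cfc (f i) U) := by
    intro i
    rw [IsSelfAdjoint, ← cfc_star]
    congr 1
    ext z
    simp [f]
  obtain ⟨M, hM1, hM2, hM3, hM4, hM5⟩ := decomp (fun i => cfc (f i) U) hsa
    (fun i j => cfc_commute_cfc _ _ _) (by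
      intro x hx
      have hu : IsUnit (cfc (∑ i, f i) U) := by
        rw [isUnit_cfc_iff _ _ (by
          have : Continuous (∑ i, f i) := by
            rw [show (∑ i, f i) = fun z => ∑ i, f i z by ext; simp]
            exact continuous_finsetSum _ fun i _ => hf i
          exact this.continuousOn)]
        intro z hz
        have hz1 : z ∈ Metric.sphere (0 : ℂ) 1 := spectrum.subset_circle_of_unitary hU hz
        obtain ⟨w, hw, hzw⟩ := Set.mem_iUnion₂.1 (htc hz1)
        rw [← hc] at hw
        obtain ⟨i, rfl⟩ := hw
        have : (0 : ℝ) < ∑ i, max 0 (δ - ‖z - c i‖) := by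
          refine Finset.sum_pos' (fun _ _ => le_max_left _ _) ⟨i, Finset.mem_univ _, ?_⟩
          rw [Metric.mem_ball, dist_eq_norm] at hzw
          exact lt_max_of_lt_right (by linarith)
        simp only [Finset.sum_apply, f]
        exact_mod_cast this.ne'
      rw [cfc_sum_univ _ _ (fun i => (hf i).continuousOn)] at hu
      obtain ⟨v, hv⟩ := hu
      have h1 : (v : H →L[ℂ] H) x = 0 := by
        rw [hv]; simp [hx]
      have h2 : ((v⁻¹ : (H →L[ℂ] H)ˣ) : H →L[ℂ] H) ((v : H →L[ℂ] H) x) = x := by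
        rw [← mul_apply_eq_comp]; simp
      rw [← h2, h1, map_zero])
  refine ⟨n, c, M, ?_, hM1, hM2, hM3, ?_⟩
  · intro i
    have : c i ∈ t := hc ▸ Set.mem_range_self i
    simpa using ht this
  intro i x hx
  refine ⟨hM5 U ?_ ?_ i x hx, ?_⟩
  · intro j
    exact (Commute.cfc (Commute.refl U) hN.star_comm_self (f j)).symm
  · intro j
    exact (Commute.cfc hN.star_comm_self.symm (Commute.refl (star U)) (f j)).symm
  have hT : (U - algebraMap ℂ _ (c i) - cfc (g i) U) * cfc (f i) U = 0 := by
    have e1 : U - algebraMap ℂ _ (c i) - cfc (g i) U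
        = cfc (fun z => z - c i - g i z) U := by
      have := hg i
      rw [cfc_sub (fun z => z - c i) (g i) U, cfc_sub (fun z => z) (fun _ => c i) U, cfc_id' ℂ U,
        cfc_const _ U]
    have := hg i
    have := hf i
    rw [e1, ← cfc_mul _ _ U (by fun_prop) (by fun_prop)]
    rw [show (fun z => (z - c i - g i z) * f i z) = fun _ => (0 : ℂ) from ?_]
    · simp
    ext z
    rcases le_or_gt δ ‖z - c i‖ with h | h
    · simp [f, h]
    · have : max 1 (‖z - c i‖ / δ) = 1 := max_eq_left ((div_le_one hδ).2 h.le)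
      simp [g, this]
  have hTx : (U - algebraMap ℂ _ (c i) - cfc (g i) U) x = 0 := by
    set T := (U - algebraMap ℂ (H →L[ℂ] H) (c i) - cfc (g i) U)
    have hT' : cfc (f i) U * star T = 0 := by
      have := congrArg star hT
      rwa [star_mul, star_zero, (hsa i).star_eq] at this
    have h0 : star T (T x) ∈ (cfc (f i) U).ker := by
      have := congrArg (fun S : H →L[ℂ] H => S (T x)) hT'
      simpa using this
    have h1 := hM4 i hx _ h0
    rw [ContinuousLinearMap.star_eq_adjoint, ContinuousLinearMap.adjoint_inner_left] at h1
    exact inner_self_eq_zero.1 h1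
  have h3 : U x - c i • x = cfc (g i) U x := by
    simpa [sub_eq_zero, Algebra.algebraMap_eq_smul_one] using hTx
  rw [h3]
  refine ContinuousLinearMap.le_of_opNorm_le _ ?_ x
  refine norm_cfc_le hδ.le fun z _ => ?_
  have hp : (0 : ℝ) < max 1 (‖z - c i‖ / δ) := lt_of_lt_of_le one_pos (le_max_left _ _)
  simp only [g, norm_div, Complex.norm_real, Real.norm_eq_abs, abs_of_pos hp]
  rw [div_le_iff₀ hp]
  calc ‖z - c i‖ = δ * (‖z - c i‖ / δ) := by field_simp
    _ ≤ _ := by gcongr; exact le_max_right _ _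

end

/-- Distinct representatives for a sequence of infinite sets. -/
lemma exists_injective_choice {ι α : Type*} [Countable ι] (S : ι → Set α)
    (hS : ∀ i, (S i).Infinite) : ∃ l : ι → α, Function.Injective l ∧ ∀ i, l i ∈ S i := by
  classical
  obtain ⟨e, he⟩ := exists_injective_nat ι
  have key : ∀ (i : ι) (t : Finset α), ∃ a ∈ S i, a ∉ t := fun i t => (hS i).exists_notMem_finset t
  choose g hg1 hg2 using key
  rcases isEmpty_or_nonempty ι with h | h
  · exact ⟨fun i => isEmptyElim i, fun i => isEmptyElim i, fun i => isEmptyElim i⟩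
  let d : ℕ → ι := Function.invFun e
  have hd : ∀ i, d (e i) = i := Function.leftInverse_invFun he
  let L : ℕ → Finset α := fun n => Nat.rec ∅ (fun k t => insert (g (d k) t) t) n
  have hL : ∀ n, L (n + 1) = insert (g (d n) (L n)) (L n) := fun n => rfl
  have hmono : Monotone L := monotone_nat_of_le_succ fun n => by
    rw [hL]; exact Finset.subset_insert _ _
  have hlt : ∀ m n, m < n → g (d m) (L m) ≠ g (d n) (L n) := by
    intro m n hmn heq
    apply hg2 (d n) (L n)
    rw [← heq]
    apply hmono (Nat.succ_le_of_lt hmn)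
    rw [Nat.succ_eq_add_one, hL]
    exact Finset.mem_insert_self _ _
  refine ⟨fun i => g i (L (e i)), ?_, fun i => hg1 _ _⟩
  intro i j hij
  apply he
  by_contra hne
  rcases lt_or_gt_of_ne hne with h | h
  · have := hlt _ _ h
    rw [hd, hd] at this
    exact this hij
  · have := hlt _ _ h
    rw [hd, hd] at this
    exact this hij.symm

lemma infinite_near {c : ℂ} (hc : ‖c‖ = 1) {δ : ℝ} (hδ : 0 < δ) :
    {z : ℂ | ‖z‖ = 1 ∧ ‖z - c‖ ≤ δ}.Infinite := by
  let φ : ℝ → ℂ := fun t => c * Complex.exp (t * Complex.I)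
  have hinj : Set.InjOn φ (Set.Ioo 0 (min δ 1)) := by
    intro s hs t ht hst
    have hc0 : c ≠ 0 := by rintro rfl; simp at hc
    have h1 := mul_left_cancel₀ hc0 hst
    have h2 := congrArg Complex.arg h1
    have hpi := Real.pi_gt_three
    have hs1 := hs.2.trans_le (min_le_right _ _)
    have ht1 := ht.2.trans_le (min_le_right _ _)
    rwa [Complex.arg_exp_mul_I, Complex.arg_exp_mul_I,
      (toIocMod_eq_self _).2 ⟨by linarith [hs.1], by linarith⟩,
      (toIocMod_eq_self _).2 ⟨by linarith [ht.1], by linarith⟩] at h2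
  refine Set.Infinite.mono ?_ ((Set.Ioo_infinite (show (0 : ℝ) < min δ 1 by positivity)).image hinj)
  rintro _ ⟨t, ht, rfl⟩
  refine ⟨by simp [φ, hc, Complex.norm_exp_ofReal_mul_I], ?_⟩
  have h1 : φ t - c = c * (Complex.exp (t * Complex.I) - 1) := by simp only [φ]; ring
  rw [h1, norm_mul, hc, one_mul]
  have h2 : ‖Complex.exp (Complex.I * t) - 1‖ ≤ ‖t‖ := Real.norm_exp_I_mul_ofReal_sub_one_le
  rw [mul_comm] at h2
  refine h2.trans ?_
  rw [Real.norm_eq_abs, abs_of_pos ht.1]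
  exact ht.2.le.trans (min_le_left _ _)

section
variable {H : Type*} [NormedAddCommGroup H] [InnerProductSpace ℂ H] [CompleteSpace H]

lemma exists_diag {ι : Type*} (b : HilbertBasis ι ℂ H) (l : ι → ℂ) (hl : ∀ i, ‖l i‖ = 1) :
    ∃ V ∈ unitary (H →L[ℂ] H), ∀ k, V (b k) = l k • b k := by
  classical
  have ho : Orthonormal ℂ (fun k => l k • b k) := by
    refine ⟨fun k => by rw [norm_smul, hl, b.orthonormal.1, one_mul], fun i j hij => ?_⟩
    change inner ℂ (l i • b i) (l j • b j) = 0
    rw [inner_smul_left, inner_smul_right, b.orthonormal.2 hij, mul_zero, mul_zero]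
  have hsp : (Submodule.span ℂ (Set.range fun k => l k • b k))ᗮ = ⊥ := by
    rw [Submodule.eq_bot_iff]
    intro x hx
    have hxb : x ∈ (Submodule.span ℂ (Set.range b))ᗮ := by
      rw [Submodule.mem_orthogonal]
      intro u hu
      induction hu using Submodule.span_induction with
      | mem u hu =>
        obtain ⟨k, rfl⟩ := hu
        have h1 := hx _ (Submodule.subset_span ⟨k, rfl⟩)
        rw [inner_smul_left] at h1
        refine (mul_eq_zero.1 h1).resolve_left ?_
        have : l k ≠ 0 := by intro h; have := hl k; simp [h] at this
        simpa using this
      | zero => simp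
      | add u v _ _ h1 h2 => rw [inner_add_left, h1, h2, add_zero]
      | smul a u _ h1 => rw [inner_smul_left, h1, mul_zero]
    rwa [(Submodule.topologicalClosure_eq_top_iff).1 b.dense_span, Submodule.mem_bot] at hxb
  let b' := HilbertBasis.mkOfOrthogonalEqBot ho hsp
  have hb' : ∀ k, b' k = l k • b k := fun k => by
    simp only [b', HilbertBasis.coe_mkOfOrthogonalEqBot]
  let e : H ≃ₗᵢ[ℂ] H := b.repr.trans b'.repr.symm
  refine ⟨Unitary.linearIsometryEquiv.symm e, (Unitary.linearIsometryEquiv.symm e).2, fun k => ?_⟩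
  change b'.repr.symm (b.repr (b k)) = _
  rw [b.repr_self, b'.repr_symm_single, hb']

lemma diag_coord {ι : Type*} (b : HilbertBasis ι ℂ H) (l : ι → ℂ) (V : H →L[ℂ] H)
    (hV : ∀ k, V (b k) = l k • b k) (x : H) (k : ι) :
    inner ℂ (b k) (V x) = l k * inner ℂ (b k) x := by
  classical
  have hx : x ∈ (Submodule.span ℂ (Set.range b)).topologicalClosure := by
    rw [b.dense_span]; trivial
  refine closure_minimal (s := (Submodule.span ℂ (Set.range b) : Set H))
    (t := {x | inner ℂ (b k) (V x) = l k * inner ℂ (b k) x}) ?_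
    (isClosed_eq (by fun_prop) (by fun_prop)) hx
  intro u hu
  induction hu using Submodule.span_induction with
  | mem u hu =>
    obtain ⟨j, rfl⟩ := hu
    change inner ℂ (b k) (V (b j)) = l k * inner ℂ (b k) (b j)
    rw [hV, inner_smul_right]
    by_cases h : k = j
    · rw [h]
    · rw [b.orthonormal.2 h, mul_zero, mul_zero]
  | zero => simp
  | add u v _ _ h1 h2 =>
    change inner ℂ (b k) (V u) = l k * inner ℂ (b k) u at h1
    change inner ℂ (b k) (V v) = l k * inner ℂ (b k) v at h2
    change inner ℂ (b k) (V (u + v)) = l k * inner ℂ (b k) (u + v)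
    rw [map_add, inner_add_right, inner_add_right, h1, h2]; ring
  | smul a u _ h1 =>
    change inner ℂ (b k) (V u) = l k * inner ℂ (b k) u at h1
    change inner ℂ (b k) (V (a • u)) = l k * inner ℂ (b k) (a • u)
    rw [map_smul, inner_smul_right, inner_smul_right, h1]; ring

lemma ext_coord {ι : Type*} (b : HilbertBasis ι ℂ H) {x y : H}
    (h : ∀ k, inner ℂ (b k) x = inner ℂ (b k) y) : x = y := by
  apply b.repr.injective
  ext k
  rw [b.repr_apply_apply, b.repr_apply_apply, h]

lemma exists_full_vector {ι : Type*} [Countable ι] (b : HilbertBasis ι ℂ H) :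
    ∃ y : H, ∀ k, inner ℂ (b k) y ≠ 0 := by
  obtain ⟨_⟩ := nonempty_encodable ι
  obtain ⟨a, ha0, s, hs, -⟩ := posSumOfEncodable one_pos ι
  have hmem : Memℓp (fun k => ((Real.sqrt (a k) : ℝ) : ℂ)) 2 := by
    apply memℓp_gen
    refine hs.summable.congr fun k => ?_
    simp [abs_of_nonneg (Real.sqrt_nonneg _), Real.sq_sqrt (ha0 k).le]
  refine ⟨b.repr.symm ⟨_, hmem⟩, fun k => ?_⟩
  rw [← b.repr_apply_apply, LinearIsometryEquiv.apply_symm_apply]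
  have := (Real.sqrt_pos.2 (ha0 k)).ne'
  change ((Real.sqrt (a k) : ℝ) : ℂ) ≠ 0
  exact_mod_cast this

lemma diag_cyclic {ι : Type*} [Countable ι] (b : HilbertBasis ι ℂ H) (l : ι → ℂ)
    (hl : ∀ i, ‖l i‖ = 1) (hinj : Function.Injective l) (V : H →L[ℂ] H)
    (hVu : V ∈ unitary (H →L[ℂ] H)) (hV : ∀ k, V (b k) = l k • b k) :
    ∃ y : H, Dense
        ((Submodule.span ℂ (Set.range fun n : ℕ => (V ^ n) y) : Submodule ℂ H) : Set H) := by
  classical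
  obtain ⟨y, hy⟩ := exists_full_vector b
  refine ⟨y, ?_⟩
  set K := Submodule.span ℂ (Set.range fun n : ℕ => (V ^ n) y)
  have hVn : ‖V‖ ≤ 1 := V.opNorm_le_bound zero_le_one fun x => by
    rw [one_mul]; exact (Unitary.norm_map ⟨V, hVu⟩ x).le
  have hb : ∀ m, b m ∈ K.topologicalClosure := by
    intro m
    have hlm : l m ≠ 0 := by intro h; have := hl m; simp [h] at this
    let T : H →L[ℂ] H := (l m)⁻¹ • V
    have hT : ‖T‖ ≤ 1 := by
      simp only [T, norm_smul, norm_inv, hl]; simpa using hVn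
    have hlim := T.tendsto_birkhoffAverage_orthogonalProjection hT y
    have hit : ∀ n, (T^[n]) y = ((l m)⁻¹) ^ n • (V ^ n) y := by
      intro n
      induction n with
      | zero => simp
      | succ n ih =>
        rw [Function.iterate_succ_apply', ih, pow_succ' V, pow_succ]
        simp [T, smul_smul]
    have hmem : ∀ n, birkhoffAverage ℂ T _root_.id n y ∈ K := by
      intro n
      rw [birkhoffAverage, birkhoffSum]
      refine K.smul_mem _ (K.sum_mem fun i _ => ?_)
      rw [id, hit]
      exact K.smul_mem _ (Submodule.subset_span ⟨i, rfl⟩)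
    have hP := mem_closure_of_tendsto hlim (Eventually.of_forall hmem)
    set P : H := ((T.eqLocus (1 : H →L[ℂ] H)).orthogonalProjectionOnto y : H) with hPdef
    have hPfix : T P = P :=
      ((T.eqLocus (1 : H →L[ℂ] H)).orthogonalProjectionOnto y).2
    have hPval : P = (inner ℂ (b m) y : ℂ) • b m := by
      apply ext_coord b
      intro k
      rw [inner_smul_right]
      by_cases h : k = m
      · subst h
        have hbk : b k ∈ T.eqLocus (1 : H →L[ℂ] H) := by
          change T (b k) = b k
          simp [T, hV, smul_smul, hlm]
        have h1 : inner ℂ (b k) (y - P) = 0 := by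
          have := Submodule.sub_starProjection_mem_orthogonal (K := T.eqLocus (1 : H →L[ℂ] H)) y
          exact this _ hbk
        rw [inner_sub_right, sub_eq_zero] at h1
        rw [← h1, inner_self_eq_norm_sq_to_K, b.orthonormal.1]; simp
      · rw [b.orthonormal.2 h, mul_zero]
        have h1 := diag_coord b l V hV P k
        have h2 : V P = l m • P := by
          conv_rhs => rw [← hPfix]
          simp [T, smul_smul, hlm]
        rw [h2, inner_smul_right] at h1
        by_contra h3
        exact h (hinj (mul_right_cancel₀ h3 h1).symm)
    have h4 : (inner ℂ (b m) y : ℂ)⁻¹ • P ∈ K.topologicalClosure :=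
      Submodule.smul_mem _ _ hP
    rwa [hPval, smul_smul, inv_mul_cancel₀ (hy m), one_smul] at h4
  rw [Submodule.dense_iff_topologicalClosure_eq_top, eq_top_iff, ← b.dense_span]
  refine Submodule.topologicalClosure_minimal _ ?_ K.isClosed_topologicalClosure
  rw [Submodule.span_le]
  rintro _ ⟨k, rfl⟩
  exact hb k

/-- Assemble Hilbert bases of the pieces. -/
lemma exists_adapted_basis {n : ℕ} (M : Fin n → Submodule ℂ H)
    (hcl : ∀ i, IsClosed (M i : Set H))
    (hM : OrthogonalFamily ℂ (fun i => M i) (fun i => (M i).subtypeₗᵢ))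
    (hd : (⨆ i, M i).topologicalClosure = ⊤) :
    ∃ (w : (i : Fin n) → Set (M i)) (b : HilbertBasis (Σ i, w i) ℂ H), ∀ k, b k ∈ M k.1 := by
  have hc : ∀ i, CompleteSpace (M i) := fun i => (hcl i).completeSpace_coe
  have hex : ∀ i, ∃ (w : Set (M i)) (b : HilbertBasis w ℂ (M i)), ⇑b = ((↑) : w → M i) :=
    fun i => exists_hilbertBasis ℂ (M i)
  choose w b hb using hex
  have ho := hM.orthonormal_sigma_orthonormal (fun i => (b i).orthonormal)
  refine ⟨w, HilbertBasis.mkOfOrthogonalEqBot ho ?_, ?_⟩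
  · rw [Submodule.eq_bot_iff]
    intro x hx
    have hMx : ∀ i, M i ≤ (ℂ ∙ x)ᗮ := by
      intro i z hz
      rw [Submodule.mem_orthogonal_singleton_iff_inner_left]
      have hz' : (⟨z, hz⟩ : M i) ∈ (Submodule.span ℂ (Set.range (b i))).topologicalClosure := by
        rw [(b i).dense_span]; trivial
      refine closure_minimal (s := (Submodule.span ℂ (Set.range (b i)) : Set (M i)))
        (t := {z : M i | inner ℂ (z : H) x = 0}) ?_
        (isClosed_eq (by fun_prop) (by fun_prop)) hz'
      have hle : Submodule.span ℂ (Set.range (b i)) ≤ ((ℂ ∙ x)ᗮ).comap (M i).subtype := by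
        rw [Submodule.span_le]
        rintro _ ⟨k, rfl⟩
        exact Submodule.mem_orthogonal_singleton_iff_inner_left.2
          (hx _ (Submodule.subset_span ⟨⟨i, k⟩, rfl⟩))
      intro u hu
      exact Submodule.mem_orthogonal_singleton_iff_inner_left.1 (hle hu)
    have hx' : x ∈ (⨆ i, M i)ᗮ := by
      rw [Submodule.mem_orthogonal]
      intro u hu
      exact Submodule.mem_orthogonal_singleton_iff_inner_left.1 (iSup_le hMx hu)
    rwa [(Submodule.topologicalClosure_eq_top_iff).1 hd, Submodule.mem_bot] at hx'
  · intro k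
    rw [HilbertBasis.coe_mkOfOrthogonalEqBot]
    exact (b k.1 k.2).2

lemma countable_basis [TopologicalSpace.SeparableSpace H] {ι : Type*} (b : HilbertBasis ι ℂ H) :
    Countable ι := by
  have hdis : Pairwise (Function.onFun Disjoint fun k => Metric.ball (b k) (1 / 2)) := by
    intro i j hij
    apply Metric.ball_disjoint_ball
    have h1 : ‖b i - b j‖ ^ 2 = 2 := by
      rw [@norm_sub_sq ℂ, b.orthonormal.1, b.orthonormal.1, b.orthonormal.2 hij]; norm_num
    rw [dist_eq_norm]
    nlinarith [norm_nonneg (b i - b j)]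
  exact hdis.countable_of_isOpen_disjoint (fun _ => Metric.isOpen_ball)
    (fun k => ⟨b k, Metric.mem_ball_self (by norm_num)⟩)
end
end CyclicUnitary


/-- Cyclic unitary operators are norm-dense in the set of all unitary operators on a separable
infinite-dimensional complex Hilbert space. -/
theorem stmt9 {H : Type*} [NormedAddCommGroup H] [InnerProductSpace ℂ H] [CompleteSpace H]
    [TopologicalSpace.SeparableSpace H] (hinf : ¬ FiniteDimensional ℂ H) :
    ∀ U ∈ unitary (H →L[ℂ] H), ∀ ε > 0, ∃ V ∈ unitary (H →L[ℂ] H),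
      ‖U - V‖ < ε ∧ ∃ y : H, Dense
        ((Submodule.span ℂ (Set.range fun n : ℕ => (V ^ n) y) : Submodule ℂ H) : Set H) := by
  intro U hU ε hε
  have hδ : 0 < ε / 3 := by positivity
  obtain ⟨n, c, M, hc, hcl, hM, hd, hUM⟩ := CyclicUnitary.exists_decomp U hU hδ
  obtain ⟨w, b, hb⟩ := CyclicUnitary.exists_adapted_basis M hcl hM hd
  have hcount := CyclicUnitary.countable_basis b
  obtain ⟨l, hlinj, hl⟩ := CyclicUnitary.exists_injective_choice
    (fun k : (Σ i, w i) => {z : ℂ | ‖z‖ = 1 ∧ ‖z - c k.1‖ ≤ ε / 3})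
    (fun k => CyclicUnitary.infinite_near (hc k.1) hδ)
  obtain ⟨V, hVu, hV⟩ := CyclicUnitary.exists_diag b l (fun k => (hl k).1)
  obtain ⟨D, hDu, hD⟩ := CyclicUnitary.exists_diag b (fun k => c k.1) (fun k => hc k.1)
  refine ⟨V, hVu, ?_, CyclicUnitary.diag_cyclic b l (fun k => (hl k).1) hlinj V hVu hV⟩
  have hDM : ∀ i, ∀ x ∈ M i, D x = c i • x := by
    intro i x hx
    apply CyclicUnitary.ext_coord b
    intro k
    rw [CyclicUnitary.diag_coord b _ D hD, inner_smul_right]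
    by_cases h : k.1 = i
    · rw [h]
    · have h0 : inner ℂ (b k) x = 0 := hM h ⟨b k, hb k⟩ ⟨x, hx⟩
      rw [h0, mul_zero, mul_zero]
  have h1 : ‖U - D‖ ≤ ε / 3 := by
    refine CyclicUnitary.norm_le_of_family M hM hd _ hδ.le fun i x hx => ?_
    rw [ContinuousLinearMap.sub_apply, hDM i x hx]
    exact ⟨(M i).sub_mem (hUM i x hx).1 ((M i).smul_mem _ hx), (hUM i x hx).2⟩
  have h2 : ‖D - V‖ ≤ ε / 3 := by
    refine CyclicUnitary.norm_le_of_family (fun k => ℂ ∙ (b k)) ?_ ?_ _ hδ.le ?_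
    · rintro i j hij ⟨x, hx⟩ ⟨y, hy⟩
      obtain ⟨s, rfl⟩ := Submodule.mem_span_singleton.1 hx
      obtain ⟨t, rfl⟩ := Submodule.mem_span_singleton.1 hy
      change inner ℂ (s • b i) (t • b j) = 0
      rw [inner_smul_left, inner_smul_right, b.orthonormal.2 hij, mul_zero, mul_zero]
    · rw [← b.dense_span, Submodule.span_range_eq_iSup]
    · intro k x hx
      obtain ⟨s, rfl⟩ := Submodule.mem_span_singleton.1 hx
      have h3 : (D - V) (s • b k) = (c k.1 - l k) • s • b k := by
        rw [ContinuousLinearMap.sub_apply, map_smul, map_smul, hD, hV, sub_smul,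
          smul_comm s, smul_comm s]
      rw [h3]
      refine ⟨Submodule.smul_mem _ _ hx, ?_⟩
      rw [norm_smul, norm_sub_rev]
      exact mul_le_mul_of_nonneg_right (hl k).2 (norm_nonneg _)
  have h4 : ‖U - V‖ ≤ ‖U - D‖ + ‖D - V‖ := norm_sub_le_norm_sub_add_norm_sub U D V
  linarith
end

section
/- Let H be a separable infinite-dimensional Hilbert space, R > 1, T a bounded operator with ‖T‖ ≤ R, x₁,…,x_n unit vectors, x ∈ H \ {0}, z ∈ H, and ε > 0. Then there exists a finite-rank operator S with ‖S‖ ≤ R, ‖(S − T)x_j‖ < ε for all j, and Sᴺ x = z for some natural number N. -/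
theorem core_aux {F : Type*} [NormedAddCommGroup F] [InnerProductSpace ℂ F]
    (A : F →L[ℂ] F) (r R : ℝ) (hA : ‖A‖ ≤ r) (hr : 1 < r) (hrR : r < R)
    (x z : F) (hx : x ≠ 0) (ε : ℝ) (hε : 0 < ε) :
    ∃ (L : ℕ) (ι : F →ₗᵢ[ℂ] PiLp 2 (fun _ : Fin L => F))
      (S : PiLp 2 (fun _ : Fin L => F) →L[ℂ] PiLp 2 (fun _ : Fin L => F)),
      ‖S‖ ≤ R ∧ (∀ f, ‖S (ι f) - ι (A f)‖ ≤ ε * ‖f‖) ∧ ∃ N : ℕ, (S ^ N) (ι x) = ι z := by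
  obtain ⟨η, hη0, hηε, hηR⟩ : ∃ η : ℝ, 0 < η ∧ η ≤ ε / 2 ∧ η ≤ (R - r) / 2 :=
    ⟨min (ε / 2) ((R - r) / 2), lt_min (by linarith) (by linarith), min_le_left _ _, min_le_right _ _⟩
  -- number of copies
  obtain ⟨m, hm⟩ : ∃ m : ℕ, (2 * r / ε) ^ 2 ≤ m := exists_nat_ge _
  set s : ℝ := (√((m : ℝ) + 1))⁻¹ with hs
  have hm1 : (0 : ℝ) < (m : ℝ) + 1 := by positivity
  have hs0 : 0 < s := by positivity
  have hs1 : s ≤ 1 := by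
    rw [hs]; apply inv_le_one_of_one_le₀
    rw [Real.one_le_sqrt]; linarith [(Nat.cast_nonneg m : (0 : ℝ) ≤ m)]
  have hs2 : ((m : ℝ) + 1) * s ^ 2 = 1 := by
    rw [hs, inv_pow, Real.sq_sqrt hm1.le]; field_simp
  have hrs : r * s ≤ ε / 2 := by
    have h1 : 2 * r / ε ≤ √((m : ℝ) + 1) := Real.le_sqrt_of_sq_le (by linarith)
    rw [hs, ← div_eq_mul_inv, div_le_iff₀ (by positivity)]
    rw [div_le_iff₀ hε] at h1
    linarith
  obtain ⟨n, hnm, hn⟩ : ∃ n : ℕ, m ≤ n ∧ ‖z‖ / (‖x‖ * (s * η) * η) ≤ r ^ n := by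
    have := (tendsto_pow_atTop_atTop_of_one_lt hr).eventually_ge_atTop (‖z‖ / (‖x‖ * (s * η) * η))
    obtain ⟨n, h1, h2⟩ := (this.and (Filter.eventually_ge_atTop m)).exists
    exact ⟨n, h2, h1⟩
  have hxn : 0 < ‖x‖ := norm_pos_iff.mpr hx
  have hr0 : 0 < r := by linarith
  -- the closing functional
  obtain ⟨C, hC, hCx⟩ : ∃ C : F →L[ℂ] F, ‖C‖ ≤ η ∧ C ((s * η * r ^ n : ℝ) • x) = z := by
    refine ⟨(((‖x‖ ^ 2 * (s * η * r ^ n))⁻¹ : ℝ) : ℂ) • (innerSL ℂ x).smulRight z, ?_, ?_⟩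
    · rw [norm_smul, ContinuousLinearMap.norm_smulRight_apply, innerSL_apply_norm,
        Complex.norm_real, Real.norm_of_nonneg (by positivity)]
      rw [div_le_iff₀ (by positivity)] at hn
      rw [inv_mul_le_iff₀ (by positivity)]
      nlinarith
    · simp only [_root_.smul_apply, ContinuousLinearMap.smulRight_apply,
        innerSL_apply_apply]
      rw [← Complex.coe_smul, inner_smul_right, inner_self_eq_norm_sq_to_K, smul_smul]
      have : (((‖x‖ ^ 2 * (s * η * r ^ n))⁻¹ : ℝ) : ℂ) * (((s * η * r ^ n : ℝ) : ℂ) * ((‖x‖ : ℝ) : ℂ) ^ 2) = 1 := by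
        norm_cast
        field_simp
      erw [this, one_smul]
  obtain ⟨L, hL⟩ : ∃ L : ℕ, L = m + n + 1 := ⟨_, rfl⟩
  have hK : ∀ v : PiLp 2 (fun _ : Fin (L + 1) => F), ‖v‖ ^ 2 = ∑ i, ‖v i‖ ^ 2 := fun v => PiLp.norm_sq_eq_of_L2 _ v
  let ι₀ : F →ₗ[ℂ] PiLp 2 (fun _ : Fin (L + 1) => F) :=
    { toFun := fun f => WithLp.toLp 2 (fun j : Fin (L + 1) => if j.val ≤ m then s • f else 0)
      map_add' := by
        intro f g; ext j; by_cases h : j.val ≤ m <;> simp [h]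
      map_smul' := by
        intro c f; ext j; by_cases h : j.val ≤ m <;> simp [h, smul_comm s c f] }
  have hι₀ : ∀ f (j : Fin (L + 1)), ι₀ f j = if j.val ≤ m then s • f else 0 := fun f j => rfl
  have hcard : (Finset.univ.filter (fun j : Fin (L + 1) => j.val ≤ m)).card = m + 1 := by
    have := Fin.card_filter_val_lt (n := L + 1) (m := m + 1)
    simp only [Nat.lt_succ_iff] at this
    rw [this]; omega
  let ι : F →ₗᵢ[ℂ] PiLp 2 (fun _ : Fin (L + 1) => F) := ⟨ι₀, fun f => by
    have : ‖ι₀ f‖ ^ 2 = ‖f‖ ^ 2 := by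
      rw [hK]
      simp only [hι₀]
      have : ∀ j : Fin (L + 1), ‖(if j.val ≤ m then s • f else 0 : F)‖ ^ 2
          = if j.val ≤ m then s ^ 2 * ‖f‖ ^ 2 else 0 := by
        intro j
        split_ifs
        · rw [norm_smul, mul_pow, Real.norm_of_nonneg hs0.le]
        · simp
      simp only [this]
      rw [← Finset.sum_filter, Finset.sum_const, hcard, nsmul_eq_mul, ← mul_assoc]
      push_cast
      rw [hs2, one_mul]
    exact (sq_eq_sq₀ (norm_nonneg _) (norm_nonneg _)).1 this⟩
  have hι : ∀ f (j : Fin (L + 1)), ι f j = if j.val ≤ m then s • f else 0 := fun f j => rfl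
  -- the weighted shift
  let B : ℕ → F →L[ℂ] F := fun i =>
    if i < m then A else if i = m then 0 else r • ContinuousLinearMap.id ℂ F
  have hB : ∀ i f, ‖B i f‖ ≤ r * ‖f‖ := by
    intro i f
    simp only [B]
    split_ifs
    · exact A.le_of_opNorm_le hA f
    · simp; positivity
    · simp [norm_smul, abs_of_pos hr0]
  let D : PiLp 2 (fun _ : Fin (L + 1) => F) →ₗ[ℂ] PiLp 2 (fun _ : Fin (L + 1) => F) :=
    { toFun := fun v => WithLp.toLp 2 (Fin.cases 0 (fun i : Fin L => B i (v i.castSucc)))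
      map_add' := by
        intro f g; ext j; refine Fin.cases ?_ (fun i => ?_) j <;> simp
      map_smul' := by
        intro c f; ext j; refine Fin.cases ?_ (fun i => ?_) j <;> simp }
  have hD0 : ∀ v, D v 0 = 0 := fun v => rfl
  have hDs : ∀ v (i : Fin L), D v i.succ = B i (v i.castSucc) := fun v i => rfl
  have hDn : ∀ v, ‖D v‖ ≤ r * ‖v‖ := by
    intro v
    refine (sq_le_sq₀ (norm_nonneg _) (by positivity)).1 ?_
    rw [mul_pow, hK, hK, Fin.sum_univ_succ, Fin.sum_univ_castSucc, hD0, mul_add, Finset.mul_sum]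
    simp only [hDs, norm_zero]
    have : ∑ i : Fin L, ‖B i (v i.castSucc)‖ ^ 2 ≤ ∑ i : Fin L, r ^ 2 * ‖v i.castSucc‖ ^ 2 := by
      apply Finset.sum_le_sum
      intro i _
      rw [← mul_pow]
      gcongr
      exact hB _ _
    have : 0 ≤ r ^ 2 * ‖v (Fin.last L)‖ ^ 2 := by positivity
    linarith
  -- the injection
  let p : Fin (L + 1) := ⟨m + 1, by omega⟩
  let E : PiLp 2 (fun _ : Fin (L + 1) => F) →ₗ[ℂ] PiLp 2 (fun _ : Fin (L + 1) => F) :=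
    { toFun := fun v => PiLp.single 2 p (η • v 0)
      map_add' := by
        intro f g; ext j; by_cases h : j = p <;> simp [h, Pi.single_apply]
      map_smul' := by
        intro c f; ext j; by_cases h : j = p <;> simp [h, smul_comm η c, Pi.single_apply] }
  have hE : ∀ v j, E v j = if j = p then η • v 0 else 0 := by
    intro v j
    show (PiLp.single 2 p (η • v 0) : PiLp 2 (fun _ : Fin (L + 1) => F)) j = _
    by_cases h : j = p <;> simp [h, Pi.single_apply]
  have hEn : ∀ v, ‖E v‖ = η * ‖v 0‖ := by
    intro v
    show ‖(PiLp.single 2 p (η • v 0) : PiLp 2 (fun _ : Fin (L + 1) => F))‖ = _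
    rw [PiLp.norm_single, norm_smul, Real.norm_of_nonneg hη0.le]
  let G : PiLp 2 (fun _ : Fin (L + 1) => F) →ₗ[ℂ] PiLp 2 (fun _ : Fin (L + 1) => F) :=
    { toFun := fun v => ι (C (v (Fin.last L)))
      map_add' := by intro f g; simp
      map_smul' := by intro c f; simp }
  have hG : ∀ v, G v = ι (C (v (Fin.last L))) := fun v => rfl
  have hGn : ∀ v, ‖G v‖ ≤ η * ‖v‖ := by
    intro v
    rw [hG, ι.norm_map]
    exact (C.le_of_opNorm_le hC _).trans (by gcongr; exact PiLp.norm_apply_le v _)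
  let S₀ : PiLp 2 (fun _ : Fin (L + 1) => F) →ₗ[ℂ] PiLp 2 (fun _ : Fin (L + 1) => F) := D + E + G
  have hS₀ : ∀ v, ‖S₀ v‖ ≤ R * ‖v‖ := by
    intro v
    have h1 : ‖E v‖ ≤ η * ‖v‖ := by rw [hEn]; gcongr; exact PiLp.norm_apply_le v _
    have h2 : ‖S₀ v‖ ≤ ‖D v‖ + ‖E v‖ + ‖G v‖ := norm_add₃_le
    nlinarith [hDn v, hGn v, norm_nonneg v]
  let S : PiLp 2 (fun _ : Fin (L + 1) => F) →L[ℂ] PiLp 2 (fun _ : Fin (L + 1) => F) := S₀.mkContinuous R hS₀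
  have hS : ∀ v, S v = D v + E v + G v := fun v => rfl
  refine ⟨L + 1, ι, S, LinearMap.mkContinuous_norm_le _ (by linarith) _, ?_, n + 2, ?_⟩
  · intro f
    have hlast : (ι f) (Fin.last L) = 0 := by
      rw [hι, if_neg]; simp only [Fin.val_last]; omega
    have hGf : G (ι f) = 0 := by rw [hG, hlast]; simp
    have hDf : D (ι f) - ι (A f) = PiLp.single 2 (0 : Fin (L + 1)) (-(s • A f)) := by
      ext j
      refine Fin.cases ?_ (fun i => ?_) j
      · rw [PiLp.sub_apply, hD0, hι]; simp
      · rw [PiLp.sub_apply, hDs, hι, hι]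
        simp only [B, Fin.val_succ, Fin.val_castSucc]
        rcases lt_trichotomy i.val m with h | h | h
        · simp [h, h.le, Nat.succ_le_of_lt h]
        · simp [h]
        · simp [not_le.2 h, not_le.2 (Nat.lt_succ_of_lt h)]
    have : S (ι f) - ι (A f) = (D (ι f) - ι (A f)) + E (ι f) := by
      rw [hS, hGf]; abel
    rw [this, hDf]
    refine (norm_add_le _ _).trans ?_
    rw [PiLp.norm_single, hEn, norm_neg, norm_smul, Real.norm_of_nonneg hs0.le]
    have h1 : ‖A f‖ ≤ r * ‖f‖ := A.le_of_opNorm_le hA f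
    have h2 : ‖ι f 0‖ ≤ ‖f‖ := by
      rw [← ι.norm_map f]; exact PiLp.norm_apply_le _ _
    have h3 : s * ‖A f‖ ≤ s * (r * ‖f‖) := by gcongr
    have h4 : η * ‖ι f 0‖ ≤ η * ‖f‖ := by gcongr
    nlinarith [norm_nonneg f]
  · have key : ∀ k : ℕ, k ≤ n → ∀ j : Fin (L + 1), ((S ^ (k + 1)) (ι x)) j =
        if j.val ≤ m then (if k + 1 ≤ j.val then s • (A ^ (k + 1)) x else 0)
        else if j.val = m + 1 + k then (s * η * r ^ k) • x else 0 := by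
      intro k
      induction k with
      | zero =>
        intro _ j
        have hlast : (ι x) (Fin.last L) = 0 := by
          rw [hι, if_neg]; simp only [Fin.val_last]; omega
        have hGf : G (ι x) = 0 := by rw [hG, hlast]; simp
        rw [zero_add, pow_one, hS, hGf, add_zero, PiLp.add_apply, hE]
        refine Fin.cases ?_ (fun i => ?_) j
        · rw [hD0]
          have : (0 : Fin (L + 1)) ≠ p := by simp [p, Fin.ext_iff]
          simp [this]
        · rw [hDs, hι, hι]
          simp only [B, Fin.val_succ, Fin.val_castSucc, p, Fin.ext_iff]
          rcases lt_trichotomy i.val m with h | h | h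
          · simp [h, h.le, h.ne, Nat.succ_le_of_lt h]
          · simp [h, smul_smul, mul_comm]
          · simp [not_le.2 h, h.ne', not_le.2 (Nat.lt_succ_of_lt h)]
      | succ k ih =>
        intro hk j
        have ih := ih (by omega)
        rw [pow_succ', ContinuousLinearMap.mul_apply, hS]
        set v := (S ^ (k + 1)) (ι x) with hv
        have hlast : v (Fin.last L) = 0 := by
          rw [ih, if_neg, if_neg] <;> simp only [Fin.val_last] <;> omega
        have h0 : v 0 = 0 := by rw [ih]; simp
        have hGf : G v = 0 := by rw [hG, hlast]; simp
        rw [hGf, add_zero, PiLp.add_apply, hE, h0, smul_zero, ite_self, add_zero]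
        refine Fin.cases ?_ (fun i => ?_) j
        · rw [hD0]; simp
        · rw [hDs, ih]
          simp only [B, Fin.val_succ, Fin.val_castSucc]
          rcases lt_trichotomy i.val m with h | h | h
          · rw [if_pos h, if_pos h.le, if_pos (show i.val + 1 ≤ m by omega)]
            by_cases h' : k + 1 ≤ i.val
            · rw [if_pos h', if_pos (show k + 1 + 1 ≤ i.val + 1 by omega), pow_succ' A (k + 1)]
              simp
            · rw [if_neg h', if_neg (show ¬ k + 1 + 1 ≤ i.val + 1 by omega)]; simp
          · rw [if_neg (show ¬ i.val < m by omega), if_pos h, if_neg (show ¬ i.val + 1 ≤ m by omega),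
              if_neg (show ¬ i.val + 1 = m + 1 + (k + 1) by omega)]; simp
          · rw [if_neg (show ¬ i.val < m by omega), if_neg (show ¬ i.val = m by omega),
              if_neg (show ¬ i.val ≤ m by omega), if_neg (show ¬ i.val + 1 ≤ m by omega)]
            by_cases h' : i.val = m + 1 + k
            · rw [if_pos h', if_pos (show i.val + 1 = m + 1 + (k + 1) by omega)]
              simp only [_root_.smul_apply, ContinuousLinearMap.id_apply, smul_smul]
              congr 1; ring
            · rw [if_neg h', if_neg (show ¬ i.val + 1 = m + 1 + (k + 1) by omega)]; simp
    have key := key n le_rfl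
    rw [pow_succ', ContinuousLinearMap.mul_apply, hS]
    set v := (S ^ (n + 1)) (ι x) with hv
    have h0 : v 0 = 0 := by rw [key]; simp
    have hlast : v (Fin.last L) = (s * η * r ^ n) • x := by
      rw [key, if_neg, if_pos] <;> simp only [Fin.val_last] <;> omega
    have hDv : D v = 0 := by
      ext j
      refine Fin.cases ?_ (fun i => ?_) j
      · rw [hD0]; rfl
      · rw [hDs, key]
        have hi : i.val < L := i.2
        simp only [Fin.val_castSucc]
        have : (if i.val ≤ m then (if n + 1 ≤ i.val then s • (A ^ (n + 1)) x else 0)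
          else if i.val = m + 1 + n then (s * η * r ^ n) • x else 0) = 0 := by
          split_ifs <;> first | rfl | omega
        rw [this]; simp
    have hEv : E v = 0 := by
      rw [← norm_eq_zero, hEn, h0]; simp
    rw [hDv, hEv, hG, hlast, hCx]; simp

theorem exists_orthonormal_seq {H : Type*} [NormedAddCommGroup H] [InnerProductSpace ℂ H]
    [CompleteSpace H] (hinf : ¬ FiniteDimensional ℂ H) : ∃ e : ℕ → H, Orthonormal ℂ e := by
  obtain ⟨w, b, hb⟩ := exists_hilbertBasis ℂ H
  have hw : Infinite w := by
    by_contra h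
    rw [not_infinite_iff_finite] at h
    have := Fintype.ofFinite w
    exact hinf (b.toOrthonormalBasis.toBasis.finiteDimensional_of_finite)
  exact ⟨fun n => b (Infinite.natEmbedding w n),
    b.orthonormal.comp _ (Infinite.natEmbedding w).injective⟩

theorem transfer_aux {H : Type*} [NormedAddCommGroup H] [InnerProductSpace ℂ H]
    [CompleteSpace H] (hinf : ¬ FiniteDimensional ℂ H)
    {F K : Type*} [NormedAddCommGroup F] [InnerProductSpace ℂ F] [FiniteDimensional ℂ F]
    [NormedAddCommGroup K] [InnerProductSpace ℂ K] [FiniteDimensional ℂ K]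
    (j : F →ₗᵢ[ℂ] H) (ι : F →ₗᵢ[ℂ] K) : ∃ W : K →ₗᵢ[ℂ] H, ∀ f, W (ι f) = j f := by
  obtain ⟨e, he⟩ := exists_orthonormal_seq hinf
  let b := stdOrthonormalBasis ℂ K
  let J₀ : K →ₗ[ℂ] H := b.toBasis.constr ℂ (fun i => e i.val)
  let J : K →ₗᵢ[ℂ] H := J₀.isometryOfOrthonormal (v := b.toBasis) (by simpa using b.orthonormal) (by
    have : J₀ ∘ b.toBasis = fun i => e i.val := by
      ext i; simp only [J₀, Function.comp, Module.Basis.constr_basis]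
    rw [this]
    exact he.comp _ Fin.val_injective)
  let G : Submodule ℂ H := LinearMap.range j.toLinearMap ⊔ LinearMap.range J.toLinearMap
  have hjG : ∀ f, j f ∈ G := fun f => Submodule.mem_sup_left ⟨f, rfl⟩
  have hJG : ∀ k, J k ∈ G := fun f => Submodule.mem_sup_right ⟨f, rfl⟩
  let j' : F →ₗᵢ[ℂ] G := ⟨j.toLinearMap.codRestrict G hjG, fun f => j.norm_map f⟩
  let J' : K →ₗᵢ[ℂ] G := ⟨J.toLinearMap.codRestrict G hJG, fun f => J.norm_map f⟩
  let q : F →ₗᵢ[ℂ] G := J'.comp ι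
  let U₀ : LinearMap.range q.toLinearMap →ₗᵢ[ℂ] G := j'.comp q.equivRange.symm.toLinearIsometry
  let U : G →ₗᵢ[ℂ] G := U₀.extend
  refine ⟨G.subtypeₗᵢ.comp (U.comp J'), fun f => ?_⟩
  have h1 : U (q f) = U₀ (q.equivRange f) := LinearIsometry.extend_apply U₀ (q.equivRange f)
  have h2 : U₀ (q.equivRange f) = j' f := by simp [U₀]
  show ((U (q f) : G) : H) = j f
  rw [h1, h2]; rfl

/-- Strong approximation lemma: given `‖T‖ ≤ R` with `R > 1`, unit vectors `x₁,…,xₙ`,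
`x ≠ 0`, `z` and `ε > 0`, there is a finite-rank `S` with `‖S‖ ≤ R`, approximating `T`
on the `xⱼ` within `ε`, and with `Sᴺ x = z` for some `N`. -/
theorem stmt10 {H : Type*} [NormedAddCommGroup H] [InnerProductSpace ℂ H] [CompleteSpace H]
    [TopologicalSpace.SeparableSpace H] (hinf : ¬ FiniteDimensional ℂ H)
    (R : ℝ) (hR : 1 < R) (T : H →L[ℂ] H) (hT : ‖T‖ ≤ R)
    (n : ℕ) (xs : Fin n → H) (hxs : ∀ j, ‖xs j‖ = 1)
    (x : H) (hx : x ≠ 0) (z : H) (ε : ℝ) (hε : 0 < ε) :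
    ∃ S : H →L[ℂ] H, FiniteDimensional ℂ (LinearMap.range (S : H →ₗ[ℂ] H)) ∧
      ‖S‖ ≤ R ∧ (∀ j, ‖(S - T) (xs j)‖ < ε) ∧ ∃ N : ℕ, (S ^ N) x = z := by
  let V : Set H := Set.range xs ∪ Set.range (fun j => T (xs j)) ∪ {x, z}
  have hV : V.Finite := by
    refine ((Set.finite_range _).union (Set.finite_range _)).union (by simp)
  let F : Submodule ℂ H := Submodule.span ℂ V
  haveI : FiniteDimensional ℂ F := FiniteDimensional.span_of_finite ℂ hV
  have hF1 : ∀ j, xs j ∈ F := fun j => Submodule.subset_span (by simp [V])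
  have hF2 : ∀ j, T (xs j) ∈ F := fun j => Submodule.subset_span (by simp [V])
  have hFx : x ∈ F := Submodule.subset_span (by simp [V])
  have hFz : z ∈ F := Submodule.subset_span (by simp [V])
  obtain ⟨r, hr1, hrR, hrε⟩ : ∃ r : ℝ, 1 < r ∧ r < R ∧ R - r ≤ ε / 2 :=
    ⟨max ((1 + R) / 2) (R - ε / 2), lt_max_of_lt_left (by linarith),
      max_lt (by linarith) (by linarith), by linarith [le_max_right ((1 + R) / 2) (R - ε / 2)]⟩
  have hR0 : 0 < R := by linarith
  have hr0 : 0 < r := by linarith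
  let A : F →L[ℂ] F := ((r / R : ℝ) : ℂ) • (F.orthogonalProjection ∘L T ∘L F.subtypeL)
  have hAn : ‖A‖ ≤ r := by
    refine ContinuousLinearMap.opNorm_le_bound _ hr0.le fun f => ?_
    have h1 : ‖F.orthogonalProjection (T f)‖ ≤ R * ‖f‖ :=
      (F.norm_orthogonalProjection_apply_le _).trans (T.le_of_opNorm_le hT _)
    have : ‖A f‖ = r / R * ‖F.orthogonalProjection (T f)‖ := by
      simp only [A, ContinuousLinearMap.smul_apply]
      rw [norm_smul, Complex.norm_real, Real.norm_of_nonneg (by positivity)]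
      rfl
    rw [this]
    calc r / R * ‖F.orthogonalProjection (T f)‖ ≤ r / R * (R * ‖f‖) := by gcongr
      _ = r * ‖f‖ := by field_simp
  have hAx : ∀ j, ‖((A ⟨xs j, hF1 j⟩ : F) : H) - T (xs j)‖ ≤ ε / 2 := by
    intro j
    have h1 : ((A ⟨xs j, hF1 j⟩ : F) : H) = ((r / R : ℝ) : ℂ) • T (xs j) := by
      have : F.orthogonalProjection (T (xs j)) = ⟨T (xs j), hF2 j⟩ :=
        Submodule.orthogonalProjection_mem_subspace_eq_self (K := F) ⟨T (xs j), hF2 j⟩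
      simp [A, this]
    have h2 : ((r / R : ℝ) : ℂ) • T (xs j) - T (xs j) = ((r / R - 1 : ℝ) : ℂ) • T (xs j) := by
      push_cast; rw [sub_smul, one_smul]
    have h3 : r / R ≤ 1 := by rw [div_le_one hR0]; exact hrR.le
    rw [h1, h2, norm_smul, Complex.norm_real, Real.norm_of_nonpos (by linarith)]
    have h4 : ‖T (xs j)‖ ≤ R := by simpa [hxs j] using T.le_of_opNorm_le hT (xs j)
    calc -(r / R - 1) * ‖T (xs j)‖ ≤ -(r / R - 1) * R := by gcongr; linarith
      _ = R - r := by field_simp; ring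
      _ ≤ ε / 2 := hrε
  obtain ⟨L, ι, S, hSn, hSx, N, hN⟩ := core_aux A r R hAn hr1 hrR ⟨x, hFx⟩ ⟨z, hFz⟩
    (by simpa [Subtype.ext_iff] using hx) (ε / 4) (by linarith)
  obtain ⟨W, hW⟩ := transfer_aux hinf F.subtypeₗᵢ ι
  let W' := W.toContinuousLinearMap
  have hWn : ‖W'‖ ≤ 1 := W.norm_toContinuousLinearMap_le
  have hWW : ∀ k, ContinuousLinearMap.adjoint W' (W k) = k := by
    intro k
    refine ext_inner_left ℂ fun y => ?_
    rw [ContinuousLinearMap.adjoint_inner_right]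
    exact W.inner_map_map y k
  let S' : H →L[ℂ] H := W' ∘L S ∘L ContinuousLinearMap.adjoint W'
  have hS' : ∀ k, S' (W k) = W (S k) := by
    intro k
    show W (S (ContinuousLinearMap.adjoint W' (W k))) = _
    rw [hWW]
  have hpow : ∀ N k, (S' ^ N) (W k) = W ((S ^ N) k) := by
    intro N
    induction N with
    | zero => intro k; simp
    | succ N ih => intro k; rw [pow_succ, pow_succ, ContinuousLinearMap.mul_apply, hS', ih]; rfl
  refine ⟨S', ?_, ?_, ?_, N, ?_⟩
  · have : LinearMap.range (S' : H →ₗ[ℂ] H) ≤ LinearMap.range W.toLinearMap := by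
      rintro _ ⟨v, rfl⟩
      exact ⟨S (ContinuousLinearMap.adjoint W' v), rfl⟩
    exact Submodule.finiteDimensional_of_le this
  · have h1 : ‖ContinuousLinearMap.adjoint W'‖ ≤ 1 := by
      rw [LinearIsometryEquiv.norm_map]; exact hWn
    refine ContinuousLinearMap.opNorm_le_bound _ hR0.le fun v => ?_
    show ‖W (S (ContinuousLinearMap.adjoint W' v))‖ ≤ _
    rw [W.norm_map]
    refine (S.le_of_opNorm_le hSn _).trans ?_
    gcongr
    simpa using (ContinuousLinearMap.adjoint W').le_of_opNorm_le h1 v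
  · intro j
    have h1 : xs j = W (ι ⟨xs j, hF1 j⟩) := (hW ⟨xs j, hF1 j⟩).symm
    have h2 : S' (xs j) = W (S (ι ⟨xs j, hF1 j⟩)) := by
      rw [← hS', ← h1]
    have h3 : ((A ⟨xs j, hF1 j⟩ : F) : H) = W (ι (A ⟨xs j, hF1 j⟩)) :=
      (hW (A ⟨xs j, hF1 j⟩)).symm
    have h4 : (S' - T) (xs j) = W (S (ι ⟨xs j, hF1 j⟩) - ι (A ⟨xs j, hF1 j⟩))
        + (((A ⟨xs j, hF1 j⟩ : F) : H) - T (xs j)) := by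
      rw [ContinuousLinearMap.sub_apply, h2, map_sub, h3]; abel
    rw [h4]
    refine (norm_add_le _ _).trans_lt ?_
    rw [W.norm_map]
    have h5 := hSx ⟨xs j, hF1 j⟩
    have h6 : ‖(⟨xs j, hF1 j⟩ : F)‖ = 1 := hxs j
    rw [h6] at h5
    linarith [hAx j]
  · have h1 : W (ι ⟨x, hFx⟩) = x := hW ⟨x, hFx⟩
    have h2 := hpow N (ι ⟨x, hFx⟩)
    rw [h1, hN] at h2
    exact h2.trans (hW ⟨z, hFz⟩)
end

section
/- Let H be a separable infinite-dimensional Hilbert space, R > 1, and x ∈ H \ {0}. Then the set of operators T with ‖T‖ ≤ R for which x is a hypercyclic vector is a dense Gδ subset of the ball B_R = {T : ‖T‖ ≤ R} equipped with the strong operator topology. -/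
/-- The strong operator topology on the closed ball of radius `R` of operators on `H`:
the topology induced by pointwise (norm) convergence. -/
def SOTball (R : ℝ) (H : Type*) [NormedAddCommGroup H] [InnerProductSpace ℂ H] :
    TopologicalSpace {T : H →L[ℂ] H // ‖T‖ ≤ R} :=
  TopologicalSpace.induced (fun T => (T.1 : H → H)) Pi.topologicalSpace

open Filter Topology TopologicalSpace
open scoped ENNReal

theorem hc_dense {K : Type*} [NormedAddCommGroup K] [NormedSpace ℂ K] [CompleteSpace K]
    [SeparableSpace K] (F B : K →L[ℂ] K) (hBF : B * F = 1)
    (hF : ∀ v, ‖F v‖ ≤ ‖v‖) (hB : ∀ v, Tendsto (fun n : ℕ => (B ^ n) v) atTop (𝓝 0))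
    (r : ℝ) (hr : 1 < r) :
    Dense {v : K | Dense (Set.range fun n : ℕ => (((r : ℂ) • B) ^ n) v)} := by
  have : SecondCountableTopology K := UniformSpace.secondCountable_of_separable K
  have hF' : ∀ n v, ‖(F ^ n) v‖ ≤ ‖v‖ := by
    intro n
    induction n with
    | zero => intro v; simp
    | succ n ih => intro v; rw [pow_succ]; exact (ih _).trans (hF v)
  have hBF' : ∀ n : ℕ, B ^ n * F ^ n = 1 := by
    intro n
    induction n with
    | zero => simp
    | succ n ih => 
      rw [pow_succ, pow_succ', mul_assoc, ← mul_assoc B F, hBF, one_mul, ih]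
  have hr0 : (r : ℂ) ≠ 0 := by exact_mod_cast (by linarith : r ≠ 0)
  have key : {v : K | Dense (Set.range fun n : ℕ => (((r : ℂ) • B) ^ n) v)} =
      ⋂ o ∈ {o ∈ countableBasis K | o.Nonempty},
        ⋃ n : ℕ, {v | (((r : ℂ) • B) ^ n) v ∈ o} := by
    ext v
    simp only [Set.mem_ofPred_eq, (isBasis_countableBasis K).dense_iff, Set.mem_iInter,
      Set.mem_iUnion, and_imp]
    refine forall_congr' fun o => forall_congr' fun _ => forall_congr' fun _ => ?_
    constructor
    · rintro ⟨_, h1, n, rfl⟩; exact ⟨n, h1⟩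
    · rintro ⟨n, h⟩; exact ⟨_, h, n, rfl⟩
  rw [key]
  apply dense_biInter_of_isOpen
  · intro o ho
    refine isOpen_iUnion fun n => ?_
    exact (isOpen_of_mem_countableBasis ho.1).preimage (((r : ℂ) • B) ^ n).continuous
  · exact (countable_countableBasis K).mono fun _ h => h.1
  · rintro o ⟨-, w, hw⟩ v
    have hz : Tendsto (fun n : ℕ => (F ^ n) ((B ^ n) v)) atTop (𝓝 0) :=
      squeeze_zero_norm (fun n => hF' n _) (tendsto_zero_iff_norm_tendsto_zero.1 (hB v))
    have hz2 : Tendsto (fun n : ℕ => ((r : ℂ)⁻¹) ^ n • (F ^ n) w) atTop (𝓝 0) := by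
      have h1 : Tendsto (fun n : ℕ => (r⁻¹) ^ n * ‖w‖) atTop (𝓝 0) := by
        simpa using (tendsto_pow_atTop_nhds_zero_of_lt_one (by positivity)
          (inv_lt_one_of_one_lt₀ hr)).mul_const ‖w‖
      refine squeeze_zero_norm (fun n => ?_) h1
      rw [norm_smul, norm_pow, norm_inv, Complex.norm_real, Real.norm_of_nonneg (by linarith)]
      gcongr
      exact hF' n w
    have hlim : Tendsto (fun n : ℕ => v - (F ^ n) ((B ^ n) v) + ((r : ℂ)⁻¹) ^ n • (F ^ n) w)
        atTop (𝓝 v) := by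
      simpa using (tendsto_const_nhds.sub hz).add hz2
    refine mem_closure_of_tendsto hlim (Eventually.of_forall fun n => ?_)
    refine Set.mem_iUnion.2 ⟨n, ?_⟩
    have e : ∀ u, (B ^ n) ((F ^ n) u) = u := fun u => by
      rw [← mul_apply_eq_comp, hBF']; rfl
    have : (((r : ℂ) • B) ^ n) (v - (F ^ n) ((B ^ n) v) + ((r : ℂ)⁻¹) ^ n • (F ^ n) w) = w := by
      rw [smul_pow, smul_apply, map_add, map_sub, map_smul, e, e, sub_self,
        zero_add, smul_smul, ← mul_pow, mul_inv_cancel₀ hr0, one_pow, one_smul]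
    simp only [Set.mem_ofPred_eq, this, hw]

theorem exists_basis_nat {H : Type*} [NormedAddCommGroup H] [InnerProductSpace ℂ H] [CompleteSpace H]
    [SeparableSpace H] (hH : ¬ FiniteDimensional ℂ H) : Nonempty (HilbertBasis ℕ ℂ H) := by
  obtain ⟨w, b, hb⟩ := exists_hilbertBasis ℂ H
  have hort := b.orthonormal
  have hc : Countable w := by
    have : SecondCountableTopology H := UniformSpace.secondCountable_of_separable H
    have : DiscreteTopology w := by
      refine DiscreteTopology.of_forall_le_dist (r := 1) one_pos ?_
      intro i j hij
      have h1 : ‖b i - b j‖ ^ 2 = 2 := by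
        rw [@norm_sub_sq ℂ, hort.1, hort.1, hort.2 hij]; norm_num
      rw [Subtype.dist_eq, dist_eq_norm]
      rw [hb] at h1
      nlinarith [norm_nonneg ((i : H) - j)]
    exact separableSpace_iff_countable.1 inferInstance
  have hi : Infinite w := by
    by_contra h
    rw [not_infinite_iff_finite] at h
    have := Fintype.ofFinite w
    exact hH (b.toOrthonormalBasis.toBasis.finiteDimensional_of_finite)
  obtain ⟨e⟩ := nonempty_equiv_of_countable (α := ℕ) (β := w)
  refine ⟨HilbertBasis.mk (hort.comp e e.injective) ?_⟩
  rw [Set.range_comp, e.range_eq_univ, Set.image_univ, b.dense_span]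

theorem equiv_sep {H K : Type*} [NormedAddCommGroup H] [InnerProductSpace ℂ H] [CompleteSpace H]
    [SeparableSpace H] (hH : ¬ FiniteDimensional ℂ H) [NormedAddCommGroup K]
    [InnerProductSpace ℂ K] [CompleteSpace K]
    [SeparableSpace K] (hK : ¬ FiniteDimensional ℂ K) : Nonempty (H ≃ₗᵢ[ℂ] K) := by
  obtain ⟨b⟩ := exists_basis_nat hH
  obtain ⟨c⟩ := exists_basis_nat hK
  exact ⟨b.repr.trans c.repr.symm⟩

theorem perp_inf {L : Type*} [NormedAddCommGroup L] [InnerProductSpace ℂ L]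
    (hL : ¬ FiniteDimensional ℂ L) (G : Submodule ℂ L) [FiniteDimensional ℂ G] :
    ¬ FiniteDimensional ℂ Gᗮ := by
  intro h
  apply hL
  have : FiniteDimensional ℂ (G ⊔ Gᗮ : Submodule ℂ L) := Submodule.finiteDimensional_sup _ _
  rw [Submodule.sup_orthogonal_of_hasOrthogonalProjection] at this
  exact Module.finite_def.2 (Module.Finite.iff_fg.1 this)

theorem extend_iso {H K : Type*} [NormedAddCommGroup H] [InnerProductSpace ℂ H] [CompleteSpace H]
    [SeparableSpace H] (hH : ¬ FiniteDimensional ℂ H) [NormedAddCommGroup K]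
    [InnerProductSpace ℂ K] [CompleteSpace K]
    [SeparableSpace K] (J : H →ₗᵢ[ℂ] K) (E : Submodule ℂ H) [FiniteDimensional ℂ E] :
    ∃ U : H ≃ₗᵢ[ℂ] K, ∀ u ∈ E, U u = J u := by
  have : SecondCountableTopology H := UniformSpace.secondCountable_of_separable H
  have : SecondCountableTopology K := UniformSpace.secondCountable_of_separable K
  have hK : ¬ FiniteDimensional ℂ K := fun h =>
    hH (FiniteDimensional.of_injective J.toLinearMap J.injective)
  set G : Submodule ℂ K := E.map J.toLinearMap with hG
  have : FiniteDimensional ℂ G := by rw [hG]; infer_instance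
  obtain ⟨Φ⟩ := equiv_sep (perp_inf hH E) (perp_inf hK G)
  let P := E.starProjection
  let Q := Eᗮ.orthogonalProjectionOnto
  let f : H →ₗ[ℂ] K := J.toLinearMap ∘ₗ P.toLinearMap +
    G ᗮ.subtype ∘ₗ Φ.toLinearEquiv.toLinearMap ∘ₗ Q.toLinearMap
  have hf : ∀ u, f u = J (P u) + (Φ (Q u) : K) := fun u => rfl
  have hPE : ∀ u, P u ∈ E := fun u => E.starProjection_apply_mem u
  have hsum : ∀ u, P u + (Q u : H) = u := fun u => by
    exact E.starProjection_add_starProjection_orthogonal u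
  have hn : ∀ u, ‖f u‖ = ‖u‖ := by
    intro u
    have h1 : ‖f u‖ * ‖f u‖ = ‖J (P u)‖ * ‖J (P u)‖ + ‖(Φ (Q u) : K)‖ * ‖(Φ (Q u) : K)‖ := by
      rw [hf]
      refine norm_add_sq_eq_norm_sq_add_norm_sq_of_inner_eq_zero _ _
        ((Φ (Q u)).2 _ ⟨P u, hPE u, rfl⟩)
    have h2 : ‖u‖ * ‖u‖ = ‖P u‖ * ‖P u‖ + ‖(Q u : H)‖ * ‖(Q u : H)‖ := by
      conv_lhs => rw [← hsum u]
      exact norm_add_sq_eq_norm_sq_add_norm_sq_of_inner_eq_zero _ _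
        ((Q u).2 _ (hPE u))
    have h3 : ‖(Φ (Q u) : K)‖ = ‖(Q u : H)‖ := Φ.norm_map _
    rw [J.norm_map, h3, ← h2] at h1
    exact (mul_self_inj (norm_nonneg _) (norm_nonneg _)).1 h1
  have hPu : ∀ u ∈ E, P u = u := fun u hu => Submodule.starProjection_eq_self_iff.2 hu
  have hQu : ∀ u ∈ E, Q u = 0 := fun u hu => by
    have := hsum u
    rw [hPu u hu] at this
    exact Subtype.ext (by simpa using this)
  have hfE : ∀ u ∈ E, f u = J u := fun u hu => by rw [hf, hPu u hu, hQu u hu]; simp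
  have hfE' : ∀ u : Eᗮ, f u = Φ u := fun u => by
    have hq : Q u = u := Submodule.orthogonalProjectionOnto_mem_subspace_eq_self u
    have := hsum u
    rw [hq] at this
    have h0 : P (u : H) = 0 := by simpa using this
    rw [hf, hq, h0]; simp
  let g : H →ₗᵢ[ℂ] K := ⟨f, hn⟩
  refine ⟨LinearIsometryEquiv.ofSurjective g ?_, fun u hu => hfE u hu⟩
  intro k
  have hk := G.starProjection_add_starProjection_orthogonal k
  obtain ⟨u, hu, hu'⟩ := G.starProjection_apply_mem k
  have h2 := Gᗮ.starProjection_apply_mem k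
  refine ⟨u + (Φ.symm ⟨_, h2⟩ : Eᗮ), ?_⟩
  change f _ = k
  rw [map_add, hfE u hu, hfE']
  conv_rhs => rw [← hk, ← hu']
  simp

theorem sot_eval {H : Type*} [NormedAddCommGroup H] [InnerProductSpace ℂ H]
    (R : ℝ) (x : H) (n : ℕ) :
    @Continuous _ _ (TopologicalSpace.induced (fun T : {T : H →L[ℂ] H // ‖T‖ ≤ R} => (T.1 : H → H)) Pi.topologicalSpace) _
    (fun T : {T : H →L[ℂ] H // ‖T‖ ≤ R} => (T.1 ^ n) x) := by
  let _ := (TopologicalSpace.induced (fun T : {T : H →L[ℂ] H // ‖T‖ ≤ R} => (T.1 : H → H)) Pi.topologicalSpace)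
  have hev : ∀ u : H, Continuous (fun T : {T : H →L[ℂ] H // ‖T‖ ≤ R} => T.1 u) := fun u =>
    (continuous_apply u).comp continuous_induced_dom
  induction n with
  | zero => simpa using continuous_const
  | succ n ih =>
    rw [continuous_iff_continuousAt] at ih ⊢
    intro T
    have h1 : Tendsto (fun S : {T : H →L[ℂ] H // ‖T‖ ≤ R} =>
        R * ‖(S.1 ^ n) x - (T.1 ^ n) x‖ + ‖S.1 ((T.1 ^ n) x) - T.1 ((T.1 ^ n) x)‖) (𝓝 T) (𝓝 0) := by
      have a := (tendsto_iff_norm_sub_tendsto_zero.1 (ih T)).const_mul R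
      have b := (tendsto_iff_norm_sub_tendsto_zero.1 ((hev ((T.1 ^ n) x)).continuousAt (x := T)))
      simpa using a.add b
    refine tendsto_iff_norm_sub_tendsto_zero.2 (squeeze_zero (fun _ => norm_nonneg _) (fun S => ?_) h1)
    simp only [pow_succ', mul_apply_eq_comp]
    calc ‖S.1 ((S.1 ^ n) x) - T.1 ((T.1 ^ n) x)‖
        = ‖S.1 ((S.1 ^ n) x - (T.1 ^ n) x) + (S.1 ((T.1 ^ n) x) - T.1 ((T.1 ^ n) x))‖ := by
          rw [map_sub]; congr 1; abel
      _ ≤ _ := (norm_add_le _ _).trans (by gcongr; exact S.1.le_of_opNorm_le S.2 _)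

theorem shift_exists (H : Type*) [NormedAddCommGroup H] [InnerProductSpace ℂ H] :
    ∃ F B : lp (fun _ : ℕ => H) 2 →L[ℂ] lp (fun _ : ℕ => H) 2, B * F = 1 ∧
      (∀ v, ‖F v‖ ≤ ‖v‖) ∧ (∀ v, ‖B v‖ ≤ ‖v‖) ∧ (∀ v i, (B v) i = v (i + 1)) ∧
      (∀ v, Tendsto (fun n : ℕ => (B ^ n) v) atTop (𝓝 0)) := by
  have h2 : 0 < (2 : ℝ≥0∞).toReal := by norm_num
  have hs : ∀ v : lp (fun _ : ℕ => H) 2, Summable fun i => ‖v i‖ ^ (2 : ℝ≥0∞).toReal :=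
    fun v => (lp.memℓp v).summable h2
  have hm : ∀ v : lp (fun _ : ℕ => H) 2, Memℓp (fun i => v (i + 1)) 2 := fun v =>
    memℓp_gen ((summable_nat_add_iff 1).2 (hs v))
  let sh : (ℕ → H) → ℕ → H := fun v i => Nat.casesOn i 0 v
  have hm' : ∀ v : lp (fun _ : ℕ => H) 2, Memℓp (sh v) 2 := fun v =>
    memℓp_gen ((summable_nat_add_iff 1).1 (hs v))
  let B0 : lp (fun _ : ℕ => H) 2 →ₗ[ℂ] lp (fun _ : ℕ => H) 2 :=
    { toFun := fun v => ⟨_, hm v⟩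
      map_add' := fun v w => rfl
      map_smul' := fun c v => rfl }
  let F0 : lp (fun _ : ℕ => H) 2 →ₗ[ℂ] lp (fun _ : ℕ => H) 2 :=
    { toFun := fun v => ⟨_, hm' v⟩
      map_add' := fun v w => by
        ext i; cases i
        · change (0 : H) = 0 + 0; simp
        · rfl
      map_smul' := fun c v => by
        ext i; cases i
        · change (0 : H) = c • (0 : H); simp
        · rfl }
  have hB : ∀ v, ‖B0 v‖ ≤ ‖v‖ := fun v => by
    refine lp.norm_le_of_tsum_le h2 (norm_nonneg _) ?_
    rw [lp.norm_rpow_eq_tsum h2, (hs v).tsum_eq_zero_add]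
    have : 0 ≤ ‖v 0‖ ^ (2 : ℝ≥0∞).toReal := by positivity
    exact le_add_of_nonneg_left this
  have hF : ∀ v, ‖F0 v‖ ≤ ‖v‖ := fun v => by
    refine lp.norm_le_of_tsum_le h2 (norm_nonneg _) ?_
    rw [lp.norm_rpow_eq_tsum h2, (hs (F0 v)).tsum_eq_zero_add]
    have : ‖F0 v 0‖ ^ (2 : ℝ≥0∞).toReal = 0 := by
      change ‖(0 : H)‖ ^ (2 : ℝ≥0∞).toReal = 0
      simp
    rw [this, zero_add]
    exact le_rfl
  let B := B0.mkContinuous 1 (fun v => by simpa using hB v)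
  let F := F0.mkContinuous 1 (fun v => by simpa using hF v)
  refine ⟨F, B, ?_, hF, hB, fun v i => rfl, ?_⟩
  · ext v i; rfl
  · intro v
    have hp : ∀ n i, ((B ^ n) v) i = v (i + n) := by
      intro n
      induction n with
      | zero => intro i; rfl
      | succ n ih =>
        intro i
        rw [pow_succ', mul_apply_eq_comp]
        change ((B ^ n) v) (i + 1) = _
        rw [ih, add_assoc, add_comm 1 n]
    have ht := _root_.tendsto_sum_nat_add fun i => ‖v i‖ ^ (2 : ℝ≥0∞).toReal
    have he : ∀ n, ‖(B ^ n) v‖ ^ (2:ℝ) = ∑' k, ‖v (k + n)‖ ^ (2 : ℝ≥0∞).toReal := by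
      intro n
      have := lp.norm_rpow_eq_tsum h2 ((B ^ n) v)
      simp only [hp] at this
      simpa using this
    have ht2 : Tendsto (fun n => ‖(B ^ n) v‖ ^ (2:ℝ)) atTop (𝓝 0) := by
      simpa only [he] using ht
    have ht3 := ht2.rpow_const (p := 1/2) (Or.inr (by norm_num))
    rw [tendsto_zero_iff_norm_tendsto_zero]
    have e : ∀ n, (‖(B ^ n) v‖ ^ (2:ℝ)) ^ (1/2:ℝ) = ‖(B ^ n) v‖ := fun n => by
      rw [← Real.rpow_mul (norm_nonneg _)]; norm_num
    simp only [e] at ht3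
    rwa [Real.zero_rpow (by norm_num)] at ht3

theorem lp_sep (H : Type*) [NormedAddCommGroup H] [InnerProductSpace ℂ H] [SeparableSpace H] :
    SeparableSpace (lp (fun _ : ℕ => H) 2) := by
  rw [← isSeparable_univ_iff]
  have h : IsSeparable (⋃ i : ℕ, Set.range (lp.single (E := fun _ : ℕ => H) 2 i)) :=
    IsSeparable.iUnion fun i => isSeparable_range (lp.isometry_single i).continuous
  refine ((h.span (R := ℂ)).closure).mono fun v _ => ?_
  have := lp.hasSum_single (p := 2) (by norm_num) v
  refine mem_closure_of_tendsto this (Eventually.of_forall fun s => ?_)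
  exact Submodule.sum_mem _ fun i _ => Submodule.subset_span (Set.mem_iUnion.2 ⟨i, _, rfl⟩)

theorem model {H : Type*} [NormedAddCommGroup H] [InnerProductSpace ℂ H] [CompleteSpace H]
    (A : H →L[ℂ] H) (hA : ‖A‖ < 1) :
    ∃ J : H →ₗᵢ[ℂ] lp (fun _ : ℕ => H) 2, ∀ u i, J (A u) i = J u (i + 1) := by
  have h2 : 0 < (2 : ℝ≥0∞).toReal := by norm_num
  have hpos : (0 : H →L[ℂ] H) ≤ 1 - star A * A := by
    rw [ContinuousLinearMap.nonneg_iff_isPositive, ContinuousLinearMap.isPositive_def']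
    refine ⟨by simp [IsSelfAdjoint], fun u => ?_⟩
    have : ‖A u‖ ≤ ‖u‖ := by
      simpa using A.le_of_opNorm_le hA.le u
    simp only [ContinuousLinearMap.reApplyInnerSelf_apply, sub_apply, one_apply_eq_self, mul_apply_eq_comp,
      ContinuousLinearMap.star_eq_adjoint, inner_sub_left, ContinuousLinearMap.adjoint_inner_left, map_sub]
    rw [inner_self_eq_norm_sq, inner_self_eq_norm_sq]
    nlinarith [norm_nonneg (A u)]
  set D : H →L[ℂ] H := CFC.sqrt (1 - star A * A) with hD
  have hDD : D * D = 1 - star A * A := CFC.sqrt_mul_sqrt_self _ hpos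
  have hDs : star D = D := (IsSelfAdjoint.of_nonneg (CFC.sqrt_nonneg _)).star_eq
  have hDn : ∀ u, ‖D u‖ ^ 2 = ‖u‖ ^ 2 - ‖A u‖ ^ 2 := by
    intro u
    have h1 : inner ℂ (D u) (D u) = inner ℂ u u - inner ℂ (A u) (A u) := by
      rw [← ContinuousLinearMap.adjoint_inner_left, ← ContinuousLinearMap.star_eq_adjoint, hDs,
        ← mul_apply_eq_comp, hDD, ← ContinuousLinearMap.adjoint_inner_left A]
      simp [inner_sub_left, ContinuousLinearMap.star_eq_adjoint]
    have := congrArg Complex.re h1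
    rw [Complex.sub_re] at this
    simp only [← @inner_self_eq_norm_sq ℂ]
    exact this
  have hpow : ∀ u, Tendsto (fun n : ℕ => ‖(A ^ n) u‖ ^ 2) atTop (𝓝 0) := by
    intro u
    have h1 : Tendsto (fun n : ℕ => ‖A‖ ^ n * ‖u‖) atTop (𝓝 0) := by
      simpa using (tendsto_pow_atTop_nhds_zero_of_lt_one (norm_nonneg A) hA).mul_const ‖u‖
    have h3 : Tendsto (fun n : ℕ => ‖(A ^ n) u‖) atTop (𝓝 0) := by
      refine squeeze_zero (fun _ => norm_nonneg _) (fun n => ?_) h1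
      induction n with
      | zero => simp
      | succ n ih =>
        rw [pow_succ', pow_succ', mul_assoc]
        exact (A.le_opNorm _).trans (mul_le_mul_of_nonneg_left ih (norm_nonneg _))
    simpa using h3.pow 2
  have hsum : ∀ u, HasSum (fun i : ℕ => ‖D ((A ^ i) u)‖ ^ (2 : ℝ≥0∞).toReal) (‖u‖ ^ 2) := by
    intro u
    rw [hasSum_iff_tendsto_nat_of_nonneg (fun i => by positivity)]
    have : ∀ n, ∑ i ∈ Finset.range n, ‖D ((A ^ i) u)‖ ^ (2 : ℝ≥0∞).toReal
        = ‖u‖ ^ 2 - ‖(A ^ n) u‖ ^ 2 := by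
      intro n
      induction n with
      | zero => simp
      | succ n ih =>
        rw [Finset.sum_range_succ, ih, pow_succ' A, mul_apply_eq_comp]
        have := hDn ((A ^ n) u)
        simp only [ENNReal.toReal_ofNat, Real.rpow_two]
        rw [this]; ring
    simp only [this]
    simpa using (tendsto_const_nhds (x := ‖u‖ ^ 2)).sub (hpow u)
  let J0 : H →ₗ[ℂ] lp (fun _ : ℕ => H) 2 :=
    { toFun := fun u => ⟨fun i => D ((A ^ i) u), memℓp_gen (hsum u).summable⟩
      map_add' := fun u v => by
        ext i
        change D ((A ^ i) (u + v)) = D ((A ^ i) u) + D ((A ^ i) v)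
        rw [map_add, map_add]
      map_smul' := fun c v => by
        ext i
        change D ((A ^ i) (c • v)) = c • D ((A ^ i) v)
        rw [map_smul, map_smul] }
  refine ⟨⟨J0, fun u => ?_⟩, fun u i => ?_⟩
  · have h := lp.norm_rpow_eq_tsum h2 (J0 u)
    have h' : ‖J0 u‖ ^ 2 = ‖u‖ ^ 2 := by
      rw [← (hsum u).tsum_eq]
      rw [← Real.rpow_two]
      exact h
    exact (sq_eq_sq₀ (norm_nonneg _) (norm_nonneg _)).1 h'
  · change D ((A ^ i) (A u)) = D ((A ^ (i + 1)) u)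
    rw [pow_succ]; rfl

theorem key_approx {H : Type*} [NormedAddCommGroup H] [InnerProductSpace ℂ H] [CompleteSpace H]
    [SeparableSpace H] (hinf : ¬ FiniteDimensional ℂ H)
    (r R : ℝ) (hr : 1 < r) (hrR : r < R) (x : H) (hx : x ≠ 0) (A : H →L[ℂ] H) (hA : ‖A‖ < r)
    (S : Set H) (hS : S.Finite) (η : ℝ) (hη : 0 < η) :
    ∃ T : H →L[ℂ] H, ‖T‖ ≤ R ∧ Dense (Set.range fun n : ℕ => (T ^ n) x) ∧
      ∀ u ∈ S, ‖T u - A u‖ ≤ η * ‖u‖ := by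
  have hr0 : 0 < r := by linarith
  have hrc : (r : ℂ) ≠ 0 := by exact_mod_cast hr0.ne'
  have := lp_sep H
  obtain ⟨F, B, hBF, hF, hB, hBi, hBt⟩ := shift_exists H
  have hA' : ‖(r : ℂ)⁻¹ • A‖ < 1 := by
    rw [norm_smul, norm_inv, Complex.norm_real, Real.norm_of_nonneg hr0.le, inv_mul_lt_one₀ hr0]
    exact hA
  obtain ⟨J, hJ⟩ := model _ hA'
  set E : Submodule ℂ H := Submodule.span ℂ (S ∪ A '' S) with hE
  have : FiniteDimensional ℂ E := FiniteDimensional.span_of_finite ℂ (hS.union (hS.image _))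
  obtain ⟨U, hU⟩ := extend_iso hinf J E
  set L : lp (fun _ : ℕ => H) 2 →L[ℂ] lp (fun _ : ℕ => H) 2 := (r : ℂ) • B with hL
  have hLn : ‖L‖ ≤ r := by
    refine L.opNorm_le_bound hr0.le fun v => ?_
    rw [hL, smul_apply, norm_smul, Complex.norm_real, Real.norm_of_nonneg hr0.le]
    gcongr
    exact hB v
  have hLU : ∀ u ∈ S, L (U u) = U (A u) := by
    intro u hu
    rw [hU u (Submodule.subset_span (Or.inl hu)),
      hU (A u) (Submodule.subset_span (Or.inr ⟨u, hu, rfl⟩))]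
    have h1 : B (J u) = J (((r : ℂ)⁻¹ • A) u) := by
      ext i
      rw [hBi, hJ]
    rw [hL, smul_apply, h1, smul_apply, map_smul, smul_smul, mul_inv_cancel₀ hrc, one_smul]
  set x0 := U x with hx0
  have hx0n : inner ℂ x0 x0 ≠ 0 := by
    rw [inner_self_ne_zero, hx0]
    simpa using hx
  let G : lp (fun _ : ℕ => H) 2 → (lp (fun _ : ℕ => H) 2 →L[ℂ] lp (fun _ : ℕ => H) 2) :=
    fun p => 1 + ((inner ℂ x0 x0)⁻¹ • innerSL ℂ x0).smulRight (p - x0)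
  have hG0 : G x0 = 1 := by ext v; simp [G]
  have hGx : ∀ p, G p x0 = p := by
    intro p
    have : G p x0 = x0 + ((inner ℂ x0 x0)⁻¹ * inner ℂ x0 x0) • (p - x0) := rfl
    rw [this, inv_mul_cancel₀ hx0n, one_smul, add_sub_cancel]
  have hGc : Continuous G := by
    refine continuous_const.add ?_
    exact ((ContinuousLinearMap.smulRightL ℂ _ _
      ((inner ℂ x0 x0)⁻¹ • innerSL ℂ x0)).continuous).comp (continuous_id.sub continuous_const)
  have hc : ContinuousAt (fun p => Ring.inverse (G p) * L * G p) x0 := by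
    have h1 : ContinuousAt (fun p => Ring.inverse (G p)) x0 := by
      refine ContinuousAt.comp (g := Ring.inverse) ?_ hGc.continuousAt
      rw [hG0]
      exact NormedRing.inverse_continuousAt 1
    exact (h1.mul continuousAt_const).mul hGc.continuousAt
  have hv : Ring.inverse (G x0) * L * G x0 = L := by simp [hG0]
  have e1 : ∀ᶠ p in 𝓝 x0, ‖Ring.inverse (G p) * L * G p‖ < R := by
    refine hc.norm.eventually_lt_const ?_
    change ‖Ring.inverse (G x0) * L * G x0‖ < R
    rw [hv]; linarith
  have e2 : ∀ᶠ p in 𝓝 x0, ‖Ring.inverse (G p) * L * G p - L‖ < η := by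
    refine (hc.sub continuousAt_const).norm.eventually_lt_const ?_
    change ‖Ring.inverse (G x0) * L * G x0 - L‖ < η
    rw [hv]; simpa using hη
  have e3 : ∀ᶠ p in 𝓝 x0, IsUnit (G p) := by
    refine hGc.continuousAt.eventually (p := fun g => IsUnit g) ?_
    rw [hG0]
    exact Units.nhds 1
  obtain ⟨p, ⟨⟨hp1, hp2⟩, hp3⟩, hpd⟩ :=
    (mem_closure_iff_nhds.1 (hc_dense F B hBF hF hBt r hr x0)) _ ((e1.and e2).and e3)
  obtain ⟨g, hg⟩ := hp3
  rw [← hg, Ring.inverse_unit] at hp1 hp2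
  set M : lp (fun _ : ℕ => H) 2 →L[ℂ] lp (fun _ : ℕ => H) 2 := ↑g⁻¹ * L * ↑g with hM
  let T : H →L[ℂ] H := (U.symm.toContinuousLinearEquiv : _ →L[ℂ] H) ∘L M ∘L
    (U.toContinuousLinearEquiv : H →L[ℂ] _)
  have hT : ∀ u, T u = U.symm (M (U u)) := fun u => rfl
  have hTn : ∀ (n : ℕ) u, (T ^ n) u = U.symm ((↑g⁻¹ : _ →L[ℂ] _) ((L ^ n) ((↑g : _ →L[ℂ] _) (U u)))) := by
    have hMn : ∀ n : ℕ, M ^ n = ↑g⁻¹ * L ^ n * ↑g := fun n => Units.conj_pow' g L n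
    have : ∀ (n : ℕ) u, (T ^ n) u = U.symm ((M ^ n) (U u)) := by
      intro n
      induction n with
      | zero => intro u; simp
      | succ n ih =>
        intro u
        rw [pow_succ', pow_succ', mul_apply_eq_comp, mul_apply_eq_comp, ih, hT,
          LinearIsometryEquiv.apply_symm_apply]
    intro n u
    rw [this, hMn]; rfl
  refine ⟨T, ?_, ?_, ?_⟩
  · refine T.opNorm_le_bound (by linarith) fun u => ?_
    rw [hT, LinearIsometryEquiv.norm_map]
    simpa using M.le_of_opNorm_le hp1.le (U u)
  · have hgx : (↑g : _ →L[ℂ] _) (U x) = p := by rw [hg]; exact hGx p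
    have hsurj : Function.Surjective fun k => U.symm ((g⁻¹.val) k) := by
      intro u
      refine ⟨(↑g : _ →L[ℂ] _) (U u), ?_⟩
      have : (g⁻¹.val) ((↑g : _ →L[ℂ] _) (U u)) = U u := by
        rw [← mul_apply_eq_comp, Units.inv_mul]; rfl
      simp only [this, LinearIsometryEquiv.symm_apply_apply]
    have hd : DenseRange fun n : ℕ => (L ^ n) p := hpd
    have := hsurj.denseRange.comp hd (U.symm.continuous.comp
      (g⁻¹.val).continuous)
    simp only [hTn, hgx]
    exact this
  · intro u hu
    have : T u - A u = U.symm ((M - L) (U u)) := by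
      rw [sub_apply, map_sub, hLU u hu, LinearIsometryEquiv.symm_apply_apply, hT]
    rw [this, LinearIsometryEquiv.norm_map]
    simpa using (M - L).le_of_opNorm_le hp2.le (U u)

theorem stmt11 {H : Type*} [NormedAddCommGroup H] [InnerProductSpace ℂ H] [CompleteSpace H]
    [TopologicalSpace.SeparableSpace H] (hinf : ¬ FiniteDimensional ℂ H)
    (R : ℝ) (hR : 1 < R) (x : H) (hx : x ≠ 0) :
    @Dense _ (SOTball R H)
      {T : {T : H →L[ℂ] H // ‖T‖ ≤ R} | Dense (Set.range fun n : ℕ => (T.1 ^ n) x)} ∧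
    @IsGδ _ (SOTball R H)
      {T : {T : H →L[ℂ] H // ‖T‖ ≤ R} | Dense (Set.range fun n : ℕ => (T.1 ^ n) x)} := by
  constructor
  · intro T0
    unfold SOTball
    rw [closure_induced, mem_closure_iff_nhds]
    intro t ht
    rw [nhds_pi, Filter.mem_pi] at ht
    obtain ⟨I, hI, s, hs, hst⟩ := ht
    have h1 : ∀ u ∈ I, ∀ᶠ c : ℝ in 𝓝[<] 1, Metric.ball (T0.1 u) ((1 - c) * (2 * R * ‖u‖ + 1)) ⊆ s u := by
      intro u _
      obtain ⟨ε, hε, hb⟩ := Metric.mem_nhds_iff.1 (hs u)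
      have hlim : Tendsto (fun c : ℝ => (1 - c) * (2 * R * ‖u‖ + 1)) (𝓝[<] 1) (𝓝 0) := by
        have : Continuous (fun c : ℝ => (1 - c) * (2 * R * ‖u‖ + 1)) := by fun_prop
        have := (this.tendsto 1).mono_left (nhdsWithin_le_nhds (s := Set.Iio 1))
        simpa using this
      filter_upwards [hlim.eventually_lt_const hε] with c hc
      exact (Metric.ball_subset_ball hc.le).trans hb
    have h2 := (eventually_all_finite hI).2 h1
    have h3 : ∀ᶠ c : ℝ in 𝓝[<] 1, 0 < c :=
      nhdsWithin_le_nhds (lt_mem_nhds one_pos)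
    obtain ⟨c, ⟨hc, hc0⟩, hc1⟩ := ((h2.and h3).and self_mem_nhdsWithin).exists
    have hc1 : c < 1 := hc1
    have hcR : c * R < R := by nlinarith
    obtain ⟨r, hrl, hrR⟩ := exists_between (max_lt hR hcR)
    have hAn : ‖(c : ℂ) • T0.1‖ < r := by
      rw [norm_smul, Complex.norm_real, Real.norm_of_nonneg hc0.le]
      exact (mul_le_mul_of_nonneg_left T0.2 hc0.le).trans_lt ((le_max_right _ _).trans_lt hrl)
    obtain ⟨T, hT, hTd, hTa⟩ := key_approx hinf r R ((le_max_left _ _).trans_lt hrl) hrR x hx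
      ((c : ℂ) • T0.1) hAn I hI ((1 - c) * R) (by nlinarith)
    refine ⟨T, hst ?_, ⟨T, hT⟩, hTd, rfl⟩
    intro u hu
    apply hc u hu
    rw [Metric.mem_ball, dist_eq_norm]
    have a1 := hTa u hu
    have a2 : ‖((c : ℂ) • T0.1) u - T0.1 u‖ ≤ (1 - c) * (R * ‖u‖) := by
      have : ((c : ℂ) • T0.1) u - T0.1 u = ((c - 1 : ℝ) : ℂ) • T0.1 u := by
        rw [smul_apply]; push_cast; rw [sub_smul, one_smul]
      rw [this, norm_smul, Complex.norm_real, Real.norm_eq_abs, abs_sub_comm,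
        abs_of_pos (by linarith)]
      exact mul_le_mul_of_nonneg_left (T0.1.le_of_opNorm_le T0.2 u) (by linarith)
    have a3 := norm_add_le (T u - ((c : ℂ) • T0.1) u) (((c : ℂ) • T0.1) u - T0.1 u)
    rw [sub_add_sub_cancel] at a3
    nlinarith
  · have : SecondCountableTopology H := UniformSpace.secondCountable_of_separable H
    have key : {T : {T : H →L[ℂ] H // ‖T‖ ≤ R} | Dense (Set.range fun n : ℕ => (T.1 ^ n) x)} =
        ⋂ o ∈ {o ∈ countableBasis H | o.Nonempty},
          ⋃ n : ℕ, {T : {T : H →L[ℂ] H // ‖T‖ ≤ R} | (T.1 ^ n) x ∈ o} := by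
      ext v
      simp only [Set.mem_ofPred_eq, (isBasis_countableBasis H).dense_iff, Set.mem_iInter,
        Set.mem_iUnion, and_imp]
      refine forall_congr' fun o => forall_congr' fun _ => forall_congr' fun _ => ?_
      constructor
      · rintro ⟨_, h1, n, rfl⟩; exact ⟨n, h1⟩
      · rintro ⟨n, h⟩; exact ⟨_, h, n, rfl⟩
    rw [key]
    let _ := SOTball R H
    refine IsGδ.biInter ((countable_countableBasis H).mono fun _ h => h.1) fun o ho => ?_
    refine (isOpen_iUnion fun n => ?_).isGδ
    exact (isOpen_of_mem_countableBasis ho.1).preimage (sot_eval R x n)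
end

section
/- Let H be a separable infinite-dimensional Hilbert space, D ⊆ H \ {0} a countable dense subset, and R > 1. Then the set of operators T with ‖T‖ ≤ R such that every x ∈ D is a hypercyclic vector for T is a dense Gδ subset of B_R in the strong operator topology. In particular, there exists an operator of norm at most R for which every element of D is hypercyclic. -/
open Filter Topology Uniformity

lemma sot_eval_cont {H : Type*} [NormedAddCommGroup H] [InnerProductSpace ℂ H] (R : ℝ) (x : H) :
    @Continuous _ _ (SOTball R H) _ (fun T : {T : H →L[ℂ] H // ‖T‖ ≤ R} => T.1 x) := by
  let := SOTball R H
  have h : Continuous (fun T : {T : H →L[ℂ] H // ‖T‖ ≤ R} => (T.1 : H → H)) :=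
    continuous_induced_dom
  exact (continuous_apply x).comp h

lemma sot_pow_cont {H : Type*} [NormedAddCommGroup H] [InnerProductSpace ℂ H] (R : ℝ) (x : H)
    (n : ℕ) :
    @Continuous _ _ (SOTball R H) _ (fun T : {T : H →L[ℂ] H // ‖T‖ ≤ R} => (T.1 ^ n) x) := by
  let := SOTball R H
  induction n with
  | zero => simpa using continuous_const
  | succ n ih =>
    rw [continuous_iff_continuousAt] at ih ⊢
    intro T0
    have h1 := ih T0
    have h2 := (sot_eval_cont R ((T0.1 ^ n) x)).continuousAt (x := T0)
    simp only [ContinuousAt] at h1 h2 ⊢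
    rw [tendsto_iff_norm_sub_tendsto_zero] at h1 h2 ⊢
    have h3 := (h1.const_mul R).add h2
    simp only [mul_zero, add_zero] at h3
    refine squeeze_zero (fun _ => norm_nonneg _) (fun T => ?_) h3
    simp only [pow_succ', mul_apply_eq_comp]
    calc ‖T.1 ((T.1 ^ n) x) - T0.1 ((T0.1 ^ n) x)‖
        = ‖T.1 ((T.1 ^ n) x - (T0.1 ^ n) x) + (T.1 ((T0.1 ^ n) x) - T0.1 ((T0.1 ^ n) x))‖ := by
          rw [map_sub]; congr 1; abel
      _ ≤ _ := norm_add_le _ _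
      _ ≤ _ := by gcongr; exact T.1.le_of_opNorm_le T.2 _

lemma baire_aux {H : Type*} [NormedAddCommGroup H] [InnerProductSpace ℂ H] [CompleteSpace H]
    (D : Set H) (hDc : D.Countable) (hDd : Dense D) (R : ℝ) (hR : 1 < R)
    {X : Type*} (ev : X → H →L[ℂ] H) (hbd : ∀ S, ‖ev S‖ ≤ R)
    (hsurj : ∀ T : H →L[ℂ] H, ‖T‖ ≤ R → ∃ S, ev S = T) :
    @BaireSpace X (TopologicalSpace.induced (fun T => (ev T : H → H)) Pi.topologicalSpace) := by
  have : Countable D := hDc.to_subtype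
  let Φ : X → D → H := fun T d => (ev T) d
  let Ψ : X → H → H := fun T d => (ev T) d
  let u : UniformSpace X := UniformSpace.comap Φ inferInstance
  have hΦ : IsUniformInducing Φ := ⟨rfl⟩
  have hev : ∀ x, UniformContinuous (fun T : X => (ev T) x) := by
    intro x
    refine Metric.uniformity_basis_dist.tendsto_right_iff.2 fun ε hε => ?_
    obtain ⟨d, hd, hxd⟩ := Metric.dense_iff.1 hDd x (ε / (3 * R)) (by positivity)
    have h1 : UniformContinuous (fun T : X => (ev T) d) :=
      (Pi.uniformContinuous_proj (fun _ : D => H) ⟨d, hxd⟩).comp hΦ.uniformContinuous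
    have h2 := Metric.uniformity_basis_dist.tendsto_right_iff.1 h1 (ε / 3) (by positivity)
    refine h2.mono ?_
    rintro ⟨S, T⟩ h
    have h' : ‖(ev S) d - (ev T) d‖ < ε / 3 := by simpa [dist_eq_norm] using h
    have hb : ∀ S : X, ‖(ev S) (x - d)‖ < ε / 3 := by
      intro S
      have hd' : ‖x - d‖ < ε / (3 * R) := by
        rw [← dist_eq_norm, dist_comm]; exact hd
      calc _ ≤ R * ‖x - d‖ := (ev S).le_of_opNorm_le (hbd S) _
        _ < R * (ε / (3 * R)) := by gcongr
        _ = ε / 3 := by field_simp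
    show dist ((ev S) x) ((ev T) x) < ε
    rw [dist_eq_norm]
    have e : (ev S) x - (ev T) x = (ev S) (x - d) + ((ev S) d - (ev T) d) - (ev T) (x - d) := by
      simp only [map_sub]; abel
    rw [e]
    have := norm_sub_le ((ev S) (x - d) + ((ev S) d - (ev T) d)) ((ev T) (x - d))
    have := norm_add_le ((ev S) (x - d)) ((ev S) d - (ev T) d)
    linarith [hb S, hb T]
  have hΨc : UniformContinuous Ψ := uniformContinuous_pi.2 hev
  have hΨ : IsUniformInducing Ψ := by
    let r : (H → H) → D → H := fun f d => f d
    have hr : UniformContinuous r :=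
      uniformContinuous_pi.2 fun d => Pi.uniformContinuous_proj (fun _ : H => H) (d : H)
    exact IsUniformInducing.of_comp hΨc hr hΦ
  have htop : u.toTopologicalSpace =
      TopologicalSpace.induced (fun T => (ev T : H → H)) Pi.topologicalSpace := hΨ.isInducing.eq_induced
  have hrange : Set.range Ψ = {f | (∀ x y, f (x + y) = f x + f y) ∧
      (∀ (c : ℂ) x, f (c • x) = c • f x) ∧ ∀ x, ‖f x‖ ≤ R * ‖x‖} := by
    ext f
    constructor
    · rintro ⟨T, rfl⟩
      exact ⟨fun x y => map_add _ _ _, fun c x => map_smul _ _ _,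
        fun x => (ev T).le_of_opNorm_le (hbd T) _⟩
    · rintro ⟨h1, h2, h3⟩
      let L : H →ₗ[ℂ] H := ⟨⟨f, h1⟩, h2⟩
      obtain ⟨S, hS⟩ := hsurj (L.mkContinuous R h3) (L.mkContinuous_norm_le (by linarith) h3)
      exact ⟨S, by ext v; simp only [Ψ, hS]; rfl⟩
  have hclosed : IsClosed (Set.range Ψ) := by
    rw [hrange]
    simp only [Set.setOf_and, Set.setOf_forall]
    refine IsClosed.inter ?_ (IsClosed.inter ?_ ?_)
    · refine isClosed_iInter fun x => isClosed_iInter fun y => isClosed_eq ?_ ?_ <;> fun_prop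
    · refine isClosed_iInter fun x => isClosed_iInter fun y => isClosed_eq ?_ ?_ <;> fun_prop
    · refine isClosed_iInter fun x => isClosed_le ?_ ?_ <;> fun_prop
  have : CompleteSpace X := (completeSpace_iff_isComplete_range hΨ).2 hclosed.isComplete
  have : (𝓤 X).IsCountablyGenerated := by
    rw [← hΦ.comap_uniformity]; infer_instance
  rw [← htop]
  let : PseudoMetricSpace X := UniformSpace.pseudoMetricSpace X
  exact BaireSpace.of_completelyPseudoMetrizable

lemma sot_baire {H : Type*} [NormedAddCommGroup H] [InnerProductSpace ℂ H] [CompleteSpace H]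
    (D : Set H) (hDc : D.Countable) (hDd : Dense D) (R : ℝ) (hR : 1 < R) :
    @BaireSpace _ (SOTball R H) :=
  baire_aux D hDc hDd R hR (fun T : {T : H →L[ℂ] H // ‖T‖ ≤ R} => T.1) (fun S => S.2)
    fun T hT => ⟨⟨T, hT⟩, rfl⟩

lemma exists_orthonormal_compl {H : Type*} [NormedAddCommGroup H] [InnerProductSpace ℂ H]
    [CompleteSpace H] (hinf : ¬ FiniteDimensional ℂ H) (E : Submodule ℂ H)
    [FiniteDimensional ℂ E] : ∃ e : ℕ → H, Orthonormal ℂ e ∧ ∀ n, e n ∈ Eᗮ := by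
  have hinf' : ¬ FiniteDimensional ℂ Eᗮ := by
    intro h
    apply hinf
    have h1 : FiniteDimensional ℂ (E ⊔ Eᗮ : Submodule ℂ H) := inferInstance
    rw [Submodule.sup_orthogonal_of_hasOrthogonalProjection] at h1
    exact Module.Finite.equiv (Submodule.topEquiv (R := ℂ) (M := H))
  let b := Module.Basis.ofVectorSpace ℂ Eᗮ
  have hI : Infinite (Module.Basis.ofVectorSpaceIndex ℂ Eᗮ) := by
    by_contra h
    have := not_infinite_iff_finite.1 h
    exact hinf' (Module.Finite.of_basis b)
  let f := Infinite.natEmbedding (Module.Basis.ofVectorSpaceIndex ℂ Eᗮ)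
  have hli : LinearIndependent ℂ (b ∘ f) := b.linearIndependent.comp f f.injective
  have ho := InnerProductSpace.gramSchmidtNormed_orthonormal hli
  refine ⟨fun n => (InnerProductSpace.gramSchmidtNormed ℂ (b ∘ f) n : Eᗮ), ?_, fun n => ?_⟩
  · exact ho.comp_linearIsometry (Eᗮ.subtypeₗᵢ)
  · exact Subtype.mem _

/-- the model operator -/
lemma key_shift {H : Type*} [NormedAddCommGroup H] [InnerProductSpace ℂ H]
    [CompleteSpace H] (E : Submodule ℂ H) [FiniteDimensional ℂ E]
    (e : ℕ → H) (he : Orthonormal ℂ e) (heE : ∀ n, e n ∈ Eᗮ)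
    (A : H →L[ℂ] H) (w c : ℝ) (hw : 1 < w) (hc : 0 < c) (hA : ‖A‖ ≤ w)
    (hAE : ∀ v, A v ∈ E) (hAE' : ∀ v ∈ Eᗮ, A v = 0) (u : H) (hu : ‖u‖ ≤ 1) (M : ℕ) :
    ∃ T : H →L[ℂ] H, ‖T‖ ≤ w + c ∧ (∀ v ∈ E, T v = A v) ∧
      (T ^ (M + 1)) (e M) = ((c * w ^ M : ℝ) : ℂ) • u := by
  let W : H →L[ℂ] H := ∑ j ∈ Finset.range M, (w : ℂ) • InnerProductSpace.rankOne ℂ (e j) (e (j+1))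
  let C : H →L[ℂ] H := (c : ℂ) • InnerProductSpace.rankOne ℂ u (e 0)
  have hWv : ∀ v, W v = (w : ℂ) • ∑ j ∈ Finset.range M, inner ℂ (e (j+1)) v • e j := by
    intro v
    simp [W, Finset.smul_sum, ContinuousLinearMap.sum_apply]
  have hCv : ∀ v, C v = (c : ℂ) • inner ℂ (e 0) v • u := by
    intro v
    simp [C]
  have hE0 : ∀ n, ∀ v ∈ E, inner ℂ (e n) v = 0 := fun n v hv =>
    Submodule.inner_left_of_mem_orthogonal hv (heE n)
  have hWn : ∀ v, ‖W v‖ ≤ w * ‖v‖ := by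
    intro v
    rw [hWv, norm_smul]
    have hw' : ‖(w : ℂ)‖ = w := by simp; linarith
    rw [hw']
    gcongr
    have h1 : ‖∑ j ∈ Finset.range M, inner ℂ (e (j+1)) v • e j‖ ^ 2
        = ∑ j ∈ Finset.range M, ‖inner ℂ (e (j+1)) v‖ ^ 2 :=
by
      have h := he.inner_sum (fun j => inner ℂ (e (j+1)) v) (fun j => inner ℂ (e (j+1)) v)
        (Finset.range M)
      rw [inner_self_eq_norm_sq_to_K] at h
      simp only [RCLike.conj_mul] at h
      exact_mod_cast h
    have h2 : ∑ j ∈ Finset.range M, ‖inner ℂ (e (j+1)) v‖ ^ 2 ≤ ‖v‖ ^ 2 :=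
      (he.comp (fun j => j + 1) (add_left_injective 1)).sum_inner_products_le v
    exact (sq_le_sq₀ (norm_nonneg _) (norm_nonneg _)).1 (h1.trans_le h2)
  have hWE : ∀ v, W v ∈ Eᗮ := by
    intro v
    rw [hWv]
    exact Submodule.smul_mem _ _ (Submodule.sum_mem _ fun j _ => Submodule.smul_mem _ _ (heE j))
  have hW0 : ∀ v ∈ E, W v = 0 := by
    intro v hv
    rw [hWv, Finset.sum_eq_zero, smul_zero]
    intro j _
    rw [hE0 _ v hv, zero_smul]
  have hAW : ‖A + W‖ ≤ w := by
    refine ContinuousLinearMap.opNorm_le_bound _ (by linarith) fun v => ?_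
    obtain ⟨p, hp, q, hq, rfl⟩ := Submodule.exists_add_mem_mem_orthogonal (K := E) v
    have h1 : (A + W) (p + q) = A p + W q := by
      simp [hAE' q hq, hW0 p hp]
    rw [h1]
    have hpq : inner ℂ p q = 0 := hq p hp
    have hAWo : inner ℂ (A p) (W q) = 0 := hWE q _ (hAE p)
    have e1 := norm_add_sq_eq_norm_sq_add_norm_sq_of_inner_eq_zero _ _ hpq
    have e2 := norm_add_sq_eq_norm_sq_add_norm_sq_of_inner_eq_zero _ _ hAWo
    have h3 : ‖A p‖ ≤ w * ‖p‖ := A.le_of_opNorm_le hA p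
    have h4 := hWn q
    have h5 := mul_self_le_mul_self (norm_nonneg _) h3
    have h6 := mul_self_le_mul_self (norm_nonneg _) h4
    refine abs_le_of_sq_le_sq' ?_ (by positivity) |>.2
    calc ‖A p + W q‖ ^ 2 = ‖A p‖ * ‖A p‖ + ‖W q‖ * ‖W q‖ := by rw [sq, e2]
      _ ≤ w * ‖p‖ * (w * ‖p‖) + w * ‖q‖ * (w * ‖q‖) := add_le_add h5 h6
      _ = w ^ 2 * (‖p + q‖ * ‖p + q‖) := by rw [e1]; ring
      _ = (w * ‖p + q‖) ^ 2 := by ring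
  have hCn : ‖C‖ ≤ c := by
    refine ContinuousLinearMap.opNorm_le_bound _ hc.le fun v => ?_
    rw [hCv, norm_smul, norm_smul]
    have h1 : ‖inner ℂ (e 0) v‖ ≤ ‖v‖ := by
      have := norm_inner_le_norm (𝕜 := ℂ) (e 0) v
      rwa [he.1 0, one_mul] at this
    have hc' : ‖(c : ℂ)‖ = c := by simp; linarith
    rw [hc']
    have : ‖inner ℂ (e 0) v‖ * ‖u‖ ≤ ‖v‖ * 1 := by gcongr
    nlinarith
  refine ⟨A + W + C, (norm_add_le _ _).trans (add_le_add hAW hCn), ?_, ?_⟩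
  · intro v hv
    simp [hW0 v hv, hCv, hE0 0 v hv]
  · have hT0 : (A + W + C) (e 0) = (c : ℂ) • u := by
      have : W (e 0) = 0 := by
        rw [hWv, Finset.sum_eq_zero, smul_zero]
        intro j _
        rw [he.2 (by simp), zero_smul]
      simp [this, hAE' _ (heE 0), hCv, he.1 0]
    have hTs : ∀ j < M, (A + W + C) (e (j+1)) = (w : ℂ) • e j := by
      intro j hj
      have h1 : W (e (j+1)) = (w : ℂ) • e j := by
        rw [hWv, Finset.sum_eq_single j]
        · simp [he.1]
        · intro i _ hi
          rw [he.2 (by simpa using hi), zero_smul]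
        · intro h; exact absurd (Finset.mem_range.2 hj) h
      have h2 : inner ℂ (e 0) (e (j+1)) = (0:ℂ) := he.2 (by simp)
      simp [h1, hAE' _ (heE _), hCv, h2]
    have : ∀ j ≤ M, ((A + W + C) ^ (j + 1)) (e j) = ((c * w ^ j : ℝ) : ℂ) • u := by
      intro j
      induction j with
      | zero => intro _; simpa using hT0
      | succ j ih =>
        intro hj
        rw [pow_succ, mul_apply_eq_comp, hTs j (by omega), map_smul, ih (by omega),
          smul_smul]
        congr 1
        push_cast
        ring
    exact this M le_rfl

lemma key_approx_s12 {H : Type*} [NormedAddCommGroup H] [InnerProductSpace ℂ H]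
    [CompleteSpace H] (hinf : ¬ FiniteDimensional ℂ H) (R : ℝ) (hR : 1 < R)
    (T₀ : H →L[ℂ] H) (hT₀ : ‖T₀‖ < R) (I : Set H) (hI : I.Finite) (ε : ℝ) (hε : 0 < ε)
    (x : H) (hx : x ≠ 0) (y : H) :
    ∃ T : H →L[ℂ] H, ‖T‖ ≤ R ∧ (∀ i ∈ I, ‖T i - T₀ i‖ < ε) ∧ ∃ n : ℕ, ‖(T ^ n) x - y‖ < ε := by
  let E : Submodule ℂ H := Submodule.span ℂ (insert x (I ∪ T₀ '' I))
  have : FiniteDimensional ℂ E :=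
    FiniteDimensional.span_of_finite ℂ ((hI.union (hI.image _)).insert x)
  have hxE : x ∈ E := Submodule.subset_span (Set.mem_insert _ _)
  have hIE : ∀ i ∈ I, i ∈ E := fun i hi => Submodule.subset_span (by simp [hi])
  have hTIE : ∀ i ∈ I, T₀ i ∈ E := fun i hi =>
    Submodule.subset_span (Or.inr (Or.inr ⟨i, hi, rfl⟩))
  obtain ⟨e, he, heE⟩ := exists_orthonormal_compl hinf E
  let P : H →L[ℂ] H := E.starProjection
  have hP : ‖P‖ ≤ 1 := E.starProjection_norm_le
  have hPE : ∀ v ∈ E, P v = v := fun v hv => Submodule.starProjection_eq_self_iff.2 hv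
  have hPm : ∀ v, P v ∈ E := fun v => Submodule.starProjection_apply_mem E v
  have hPo : ∀ v ∈ Eᗮ, P v = 0 := fun v hv => by
    exact (Submodule.starProjection_apply_eq_zero_iff E).2 hv
  let A : H →L[ℂ] H := P * T₀ * P
  have hAn : ‖A‖ ≤ ‖T₀‖ := by
    calc ‖A‖ ≤ ‖P‖ * ‖T₀‖ * ‖P‖ := (norm_mul_le _ _).trans (by gcongr; exact norm_mul_le _ _)
      _ ≤ 1 * ‖T₀‖ * 1 := by gcongr
      _ = _ := by ring
  have hAE : ∀ v, A v ∈ E := fun v => hPm _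
  have hAo : ∀ v ∈ Eᗮ, A v = 0 := fun v hv => by
    simp [A, mul_apply_eq_comp, hPo v hv]
  have hAI : ∀ i ∈ I, A i = T₀ i := fun i hi => by
    simp [A, mul_apply_eq_comp, hPE i (hIE i hi), hPE _ (hTIE i hi)]
  obtain ⟨w, hw1, hw2⟩ := exists_between (max_lt hR hT₀)
  have hw : 1 < w := (le_max_left _ _).trans_lt hw1
  have hTw : ‖T₀‖ < w := (le_max_right _ _).trans_lt hw1
  let c := (R - w) / 2
  have hc : 0 < c := by simp only [c]; linarith
  -- the size of the correction
  let t : ℕ → ℝ := fun M => ‖y - (A ^ (M + 1)) x‖ / (c * w ^ M)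
  have ht : Tendsto t atTop (𝓝 0) := by
    have h1 : Tendsto (fun M : ℕ => ‖y‖ / c * (1 / w) ^ M +
        ‖T₀‖ * ‖x‖ / c * (‖T₀‖ / w) ^ M) atTop (𝓝 (‖y‖ / c * 0 + ‖T₀‖ * ‖x‖ / c * 0)) := by
      refine Tendsto.add ?_ ?_ <;> refine Tendsto.const_mul _ ?_
      · exact tendsto_pow_atTop_nhds_zero_of_lt_one (by positivity)
          ((div_lt_one (by linarith)).2 hw)
      · exact tendsto_pow_atTop_nhds_zero_of_lt_one (by positivity)
          ((div_lt_one (by linarith)).2 hTw)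
    simp only [mul_zero, add_zero] at h1
    refine squeeze_zero (fun M => by positivity) (fun M => ?_) h1
    have h2 : ‖(A ^ (M + 1)) x‖ ≤ ‖T₀‖ ^ (M + 1) * ‖x‖ := by
      refine (A ^ (M + 1)).le_of_opNorm_le ?_ x
      exact (norm_pow_le' A (Nat.succ_pos M)).trans (by gcongr)
    have h3 : ‖y - (A ^ (M + 1)) x‖ ≤ ‖y‖ + ‖T₀‖ ^ (M + 1) * ‖x‖ :=
      (norm_sub_le _ _).trans (by gcongr)
    have hwp : 0 < w := by linarith
    calc t M ≤ (‖y‖ + ‖T₀‖ ^ (M + 1) * ‖x‖) / (c * w ^ M) := by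
          simp only [t]; gcongr
      _ = _ := by
          rw [div_pow, div_pow, one_pow, pow_succ]; field_simp
  have hxn : 0 < ‖x‖ := norm_pos_iff.2 hx
  -- smallness requirements
  have hq : Tendsto (fun M => t M / ‖x‖) atTop (𝓝 0) := by simpa using ht.div_const ‖x‖
  have hs1 : Tendsto (fun M => R * (2 * (t M / ‖x‖) + (t M / ‖x‖) ^ 2)) atTop (𝓝 0) := by
    have := ((hq.const_mul 2).add (hq.pow 2)).const_mul R
    simpa using this
  have hs2 : Tendsto (fun M => (t M / ‖x‖) * ‖y‖) atTop (𝓝 0) := by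
    simpa using hq.mul_const ‖y‖
  -- a constant by which the vectors of I are bounded
  obtain ⟨K, hK⟩ : ∃ K : ℝ, ∀ i ∈ I, ‖i‖ ≤ K := hI.isBounded.exists_norm_le
  have hs3 : Tendsto (fun M => R * (2 * (t M / ‖x‖) + (t M / ‖x‖) ^ 2) * K) atTop (𝓝 0) := by
    simpa using hs1.mul_const K
  obtain ⟨M, hM1, hM2, hM3⟩ := ((hs1.eventually_lt_const hc).and
    ((hs2.eventually_lt_const hε).and (hs3.eventually_lt_const hε))).exists
  set q := t M / ‖x‖ with hqdef
  have htM : 0 ≤ t M := by simp only [t]; positivity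
  have hq0 : 0 ≤ q := by positivity
  let z := y - (A ^ (M + 1)) x
  obtain ⟨T, hTn, hTE, hTM⟩ := key_shift E e he heE A w c hw hc (hAn.trans hTw.le) hAE hAo
    (((‖z‖⁻¹ : ℝ) : ℂ) • z) (by
      rw [norm_smul]
      simp only [Complex.norm_real, norm_inv, norm_norm]
      exact inv_mul_le_one) M
  have hwc : w + c = R - c := by simp only [c]; ring
  have hTR : ‖T‖ ≤ R := by linarith
  have hTx : ∀ n, (T ^ n) x = (A ^ n) x ∧ (A ^ n) x ∈ E := by
    intro n
    induction n with
    | zero => simpa using hxE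
    | succ n ih =>
      rw [pow_succ', pow_succ', mul_apply_eq_comp, mul_apply_eq_comp, ih.1]
      exact ⟨hTE _ ih.2, hAE _⟩
  have hTx' : (T ^ (M + 1)) (x + (t M : ℂ) • e M) = y := by
    rw [map_add, map_smul, hTM, (hTx _).1, smul_smul, smul_smul, ← Complex.ofReal_mul,
      ← Complex.ofReal_mul]
    by_cases hz : ‖z‖ = 0
    · have hz' : z = 0 := norm_eq_zero.1 hz
      rw [hz', smul_zero, add_zero]
      exact (sub_eq_zero.1 hz').symm
    · have : t M * (c * w ^ M) * ‖z‖⁻¹ = 1 := by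
        have hwp : 0 < w := by linarith
        show ‖z‖ / (c * w ^ M) * (c * w ^ M) * ‖z‖⁻¹ = 1
        field_simp
      rw [this]
      simp [z]
  -- conjugation
  let Q : H →L[ℂ] H := ((t M / ‖x‖ ^ 2 : ℝ) : ℂ) • InnerProductSpace.rankOne ℂ (e M) x
  have hQv : ∀ v, Q v = ((t M / ‖x‖ ^ 2 : ℝ) : ℂ) • inner ℂ x v • e M := by
    intro v; rfl
  have hQx : Q x = (t M : ℂ) • e M := by
    rw [hQv, inner_self_eq_norm_sq_to_K, smul_smul]
    congr 1
    have : (‖x‖ : ℂ) ≠ 0 := by exact_mod_cast hxn.ne'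
    push_cast
    field_simp
    try rfl
  have hQb : ∀ v, ‖Q v‖ ≤ q * ‖v‖ := by
    intro v
    rw [hQv, norm_smul, norm_smul, he.1, mul_one, Complex.norm_real, Real.norm_of_nonneg (by positivity)]
    calc _ ≤ t M / ‖x‖ ^ 2 * (‖x‖ * ‖v‖) := by gcongr; exact norm_inner_le_norm _ _
      _ = q * ‖v‖ := by rw [hqdef]; field_simp
  have hQn : ‖Q‖ ≤ q := Q.opNorm_le_bound hq0 hQb
  have hQQ : Q * Q = 0 := by
    ext v
    have : inner ℂ x (e M) = (0 : ℂ) := heE M x hxE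
    rw [mul_apply_eq_comp, hQv v, map_smul, map_smul, hQv (e M), this]
    simp
  let S := (1 - Q) * T * (1 + Q)
  have hS : ‖S - T‖ ≤ R * (2 * q + q ^ 2) := by
    have : S - T = T * Q - Q * T - Q * T * Q := by simp only [S]; noncomm_ring
    rw [this]
    have h1 : ‖T * Q‖ ≤ R * q := (norm_mul_le _ _).trans (by gcongr)
    have h2 : ‖Q * T‖ ≤ q * R := (norm_mul_le _ _).trans (by gcongr)
    have h3 : ‖Q * T * Q‖ ≤ q * R * q := (norm_mul_le _ _).trans (by gcongr)
    have h4 := norm_sub_le (T * Q - Q * T) (Q * T * Q)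
    have h5 := norm_sub_le (T * Q) (Q * T)
    nlinarith
  have hinv : (1 + Q) * (1 - Q) = 1 := by
    have : (1 + Q) * (1 - Q) = 1 - Q * Q := by noncomm_ring
    rw [this, hQQ, sub_zero]
  have hinv' : (1 - Q) * (1 + Q) = 1 := by
    have : (1 - Q) * (1 + Q) = 1 - Q * Q := by noncomm_ring
    rw [this, hQQ, sub_zero]
  have hSn : ∀ n, S ^ n = (1 - Q) * T ^ n * (1 + Q) := by
    intro n
    induction n with
    | zero => simp [hinv']
    | succ n ih =>
      rw [pow_succ, ih, pow_succ]
      calc _ = (1 - Q) * T ^ n * ((1 + Q) * (1 - Q)) * T * (1 + Q) := by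
            simp only [S, mul_assoc]
        _ = _ := by rw [hinv, mul_one]; simp only [mul_assoc]
  refine ⟨S, ?_, ?_, M + 1, ?_⟩
  · have : S = T + (S - T) := by abel
    rw [this]
    have := norm_add_le T (S - T)
    linarith
  · intro i hi
    rw [← hAI i hi, ← hTE i (hIE i hi), ← sub_apply]
    refine lt_of_le_of_lt ?_ hM3
    refine ((S - T).le_of_opNorm_le hS i).trans ?_
    have : 0 ≤ R * (2 * q + q ^ 2) := by positivity
    exact mul_le_mul_of_nonneg_left (hK i hi) this
  · have : (S ^ (M + 1)) x - y = - Q y := by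
      rw [hSn, mul_apply_eq_comp, mul_apply_eq_comp]
      have : (1 + Q) x = x + (t M : ℂ) • e M := by simp [hQx]
      rw [this, hTx']
      simp
    rw [this, norm_neg]
    exact (hQb y).trans_lt hM2

theorem key_dense {H : Type*} [NormedAddCommGroup H] [InnerProductSpace ℂ H]
    [CompleteSpace H] (hinf : ¬ FiniteDimensional ℂ H) (R : ℝ) (hR : 1 < R)
    (x : H) (hx : x ≠ 0) (V : Set H) (hV : IsOpen V) (hVn : V.Nonempty) :
    @Dense _ (SOTball R H) {T : {T : H →L[ℂ] H // ‖T‖ ≤ R} | ∃ n : ℕ, (T.1 ^ n) x ∈ V} := by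
  let := SOTball R H
  have hind : IsInducing (fun T : {T : H →L[ℂ] H // ‖T‖ ≤ R} => (T.1 : H → H)) := ⟨rfl⟩
  obtain ⟨y, hy⟩ := hVn
  obtain ⟨δ, hδ, hball⟩ := Metric.isOpen_iff.1 hV y hy
  intro T₀
  rw [mem_closure_iff_nhds]
  intro U hU
  rw [hind.nhds_eq_comap, mem_comap] at hU
  obtain ⟨t, ht, htU⟩ := hU
  rw [nhds_pi] at ht
  obtain ⟨⟨I, r⟩, ⟨hI, hr⟩, hIt⟩ :=
    (hasBasis_pi (fun i => Metric.nhds_basis_ball (x := T₀.1 i))).mem_iff.1 ht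
  obtain ⟨ε, hε, hεr⟩ : ∃ ε > 0, ∀ i ∈ I, ε ≤ r i := by
    have h := (hI.eventually_all (l := 𝓝[>] (0:ℝ)) (p := fun i ε => ε ≤ r i)).2 (fun i hi =>
      mem_of_superset (Ioc_mem_nhdsGT (hr i hi)) fun z hz => hz.2)
    obtain ⟨ε, h1, h2⟩ := (h.and self_mem_nhdsWithin).exists
    exact ⟨ε, h2, h1⟩
  -- shrink
  obtain ⟨K, hK⟩ : ∃ K : ℝ, ∀ i ∈ I, ‖i‖ ≤ K := hI.isBounded.exists_norm_le
  have hK' : Tendsto (fun s : ℝ => (1 - s) * (R * K)) (𝓝[<] 1) (𝓝 0) := by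
    have : Continuous (fun s : ℝ => (1 - s) * (R * K)) := by fun_prop
    have := (this.tendsto 1).mono_left (nhdsWithin_le_nhds (s := Set.Iio 1))
    simpa using this
  obtain ⟨s, hs1, hs0⟩ := ((hK'.eventually_lt_const (half_pos hε)).and
    (Ioo_mem_nhdsLT (zero_lt_one (α := ℝ)))).exists
  have hs2' : s < 1 := hs0.2
  have hs0' : 0 < s := hs0.1
  have hn : ‖(s : ℂ) • T₀.1‖ < R := by
    rw [norm_smul, Complex.norm_real, Real.norm_of_nonneg hs0'.le]
    have := T₀.2
    nlinarith [norm_nonneg T₀.1]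
  obtain ⟨T, hT, hTI, n, hTn⟩ := key_approx_s12 hinf R hR ((s : ℂ) • T₀.1) hn I hI (min (ε / 2) δ)
    (by positivity) x hx y
  refine ⟨⟨T, hT⟩, htU (hIt fun i hi => ?_), n, hball ?_⟩
  · refine Metric.ball_subset_ball (hεr i hi) ?_
    show dist (T i) (T₀.1 i) < ε
    have h1 := (hTI i hi).trans_le (min_le_left _ _)
    have h2 : ‖((s : ℂ) • T₀.1) i - T₀.1 i‖ ≤ (1 - s) * (R * K) := by
      have e1 : ((s : ℂ) • T₀.1) i - T₀.1 i = ((s - 1 : ℝ) : ℂ) • T₀.1 i := by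
        push_cast
        rw [sub_smul, one_smul]; rfl
      rw [e1, norm_smul, Complex.norm_real, Real.norm_of_nonpos (by linarith), neg_sub]
      have : ‖T₀.1 i‖ ≤ R * K :=
        (T₀.1.le_of_opNorm_le T₀.2 i).trans (by gcongr; exact hK i hi)
      exact mul_le_mul_of_nonneg_left this (by linarith)
    have h3 := dist_triangle (T i) (((s : ℂ) • T₀.1) i) (T₀.1 i)
    rw [dist_eq_norm, dist_eq_norm] at h3
    rw [dist_eq_norm] at h3 ⊢
    linarith
  · rw [Metric.mem_ball, dist_eq_norm]
    exact hTn.trans_le (min_le_right _ _)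

/-- For `R > 1` and a countable dense set `D` of nonzero vectors, the set of operators in
`B_R` for which every `x ∈ D` is hypercyclic is dense Gδ in the strong operator topology;
in particular such an operator exists. -/
theorem stmt12 {H : Type*} [NormedAddCommGroup H] [InnerProductSpace ℂ H] [CompleteSpace H]
    [TopologicalSpace.SeparableSpace H] (hinf : ¬ FiniteDimensional ℂ H)
    (D : Set H) (hDc : D.Countable) (hDd : Dense D) (hD0 : 0 ∉ D)
    (R : ℝ) (hR : 1 < R) :
    (@Dense _ (SOTball R H)
      {T : {T : H →L[ℂ] H // ‖T‖ ≤ R} |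
        ∀ x ∈ D, Dense (Set.range fun n : ℕ => (T.1 ^ n) x)} ∧
     @IsGδ _ (SOTball R H)
      {T : {T : H →L[ℂ] H // ‖T‖ ≤ R} |
        ∀ x ∈ D, Dense (Set.range fun n : ℕ => (T.1 ^ n) x)}) ∧
    ∃ T : H →L[ℂ] H, ‖T‖ ≤ R ∧ ∀ x ∈ D, Dense (Set.range fun n : ℕ => (T ^ n) x) := by
  let : TopologicalSpace {T : H →L[ℂ] H // ‖T‖ ≤ R} := SOTball R H
  have : BaireSpace {T : H →L[ℂ] H // ‖T‖ ≤ R} := sot_baire D hDc hDd R hR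
  let B := TopologicalSpace.countableBasis H
  let G : H × Set H → Set {T : H →L[ℂ] H // ‖T‖ ≤ R} :=
    fun p => {T | ∃ n : ℕ, (T.1 ^ n) p.1 ∈ p.2}
  have hBc : B.Countable := TopologicalSpace.countable_countableBasis H
  have hB : TopologicalSpace.IsTopologicalBasis B := TopologicalSpace.isBasis_countableBasis H
  have hSc : (D ×ˢ B).Countable := hDc.prod hBc
  have heq : {T : {T : H →L[ℂ] H // ‖T‖ ≤ R} |
      ∀ x ∈ D, Dense (Set.range fun n : ℕ => (T.1 ^ n) x)} = ⋂ p ∈ D ×ˢ B, G p := by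
    ext T
    simp only [Set.mem_setOf_eq, Set.mem_iInter, Set.mem_prod, and_imp, Prod.forall, G]
    refine ⟨fun h x V hx hV => ?_, fun h x hx => hB.dense_iff.2 fun V hV _ => ?_⟩
    · obtain ⟨_, hz, n, rfl⟩ :=
        hB.dense_iff.1 (h x hx) V hV (TopologicalSpace.nonempty_of_mem_countableBasis hV)
      exact ⟨n, hz⟩
    · obtain ⟨n, hn⟩ := h x V hx hV
      exact ⟨_, hn, n, rfl⟩
  have hopen : ∀ p ∈ D ×ˢ B, IsOpen (G p) := by
    intro p hp
    have : G p = ⋃ n : ℕ, (fun T : {T : H →L[ℂ] H // ‖T‖ ≤ R} => (T.1 ^ n) p.1) ⁻¹' p.2 := by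
      ext T; simp [G]
    rw [this]
    exact isOpen_iUnion fun n => (hB.isOpen hp.2).preimage (sot_pow_cont R p.1 n)
  have hdense : Dense (⋂ p ∈ D ×ˢ B, G p) :=
    dense_biInter_of_isOpen hopen hSc fun p hp =>
      key_dense hinf R hR p.1 (fun h => hD0 (h ▸ hp.1)) p.2 (hB.isOpen hp.2)
        (TopologicalSpace.nonempty_of_mem_countableBasis hp.2)
  rw [heq]
  refine ⟨⟨hdense, IsGδ.biInter_of_isOpen hSc hopen⟩, ?_⟩
  have : Nonempty {T : H →L[ℂ] H // ‖T‖ ≤ R} := ⟨⟨0, by rw [norm_zero]; linarith⟩⟩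
  obtain ⟨T, hT⟩ := hdense.nonempty
  rw [← heq] at hT
  exact ⟨T.1, T.2, hT⟩
end

section
/- Let H be a separable infinite-dimensional Hilbert space, D ⊆ H \ {0} countable dense, and R > 0. Then the set of operators T with ‖T‖ ≤ R for which every x ∈ D is a supercyclic vector is a dense Gδ subset of B_R in the strong operator topology. -/
open Filter Topology

theorem exists_seq {K : Type*} [NormedAddCommGroup K] [InnerProductSpace ℂ K]
    (h : ¬ FiniteDimensional ℂ K) : ∃ e : ℕ → K, Orthonormal ℂ e := by
  let b := Module.Basis.ofVectorSpace ℂ K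
  have hi : Infinite (Module.Basis.ofVectorSpaceIndex ℂ K) := by
    by_contra hc
    rw [not_infinite_iff_finite] at hc
    exact h (Module.Finite.of_basis b)
  let f := Infinite.natEmbedding (Module.Basis.ofVectorSpaceIndex ℂ K)
  have hl : LinearIndependent ℂ (b ∘ f) := b.linearIndependent.comp f f.injective
  exact ⟨_, InnerProductSpace.gramSchmidtNormed_orthonormal hl⟩

theorem op_exists {H : Type*} [NormedAddCommGroup H] [InnerProductSpace ℂ H]
    (hinf : ¬ FiniteDimensional ℂ H) (V : Submodule ℂ H) [FiniteDimensional ℂ V]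
    (B : H →L[ℂ] H) (hBV : ∀ z, B z ∈ V) (hBP : ∀ z, B (V.starProjection z) = B z)
    (w : ℝ) (hw : 0 ≤ w) (hB : ‖B‖ ≤ w) (v : H) (m : ℕ) :
    ∃ e0 : H, ‖e0‖ = 1 ∧ e0 ∈ Vᗮ ∧ ∃ T : H →L[ℂ] H, ‖T‖ ≤ w + ‖v‖ ∧ (∀ z ∈ V, T z = B z) ∧
      (T ^ (m + 1)) e0 = ((w : ℂ) ^ m) • v := by
  have hV : ¬ FiniteDimensional ℂ Vᗮ := by
    intro h
    apply hinf
    have : FiniteDimensional ℂ (V ⊔ Vᗮ : Submodule ℂ H) := inferInstance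
    rw [Submodule.sup_orthogonal_of_hasOrthogonalProjection] at this
    exact Module.Finite.equiv (Submodule.topEquiv (R := ℂ) (M := H))
  obtain ⟨e', he'⟩ := exists_seq hV
  let e : ℕ → H := fun i => (e' i : H)
  have he : Orthonormal ℂ e := he'.comp_linearIsometry Vᗮ.subtypeₗᵢ
  have heV : ∀ i, e i ∈ Vᗮ := fun i => (e' i).2
  have hee : ∀ i j, inner ℂ (e i) (e j) = if i = j then (1:ℂ) else 0 := fun i j => by
    rw [orthonormal_iff_ite] at he; exact he i j
  have heV0 : ∀ i, ∀ z ∈ V, inner ℂ (e i) z = (0:ℂ) := fun i z hz =>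
    (Submodule.mem_orthogonal' V _).1 (heV i) z hz
  let S : H →L[ℂ] H := ∑ i ∈ Finset.range m, (innerSL ℂ (e i)).smulRight (e (i+1))
  have hS : ∀ z, S z = ∑ i ∈ Finset.range m, (inner ℂ (e i) z : ℂ) • e (i+1) := fun z => by
    simp [S]
  have hSn : ∀ z, ‖S z‖ ^ 2 ≤ ‖Vᗮ.starProjection z‖ ^ 2 := by
    intro z
    have he1 : Orthonormal ℂ (fun i => e (i+1)) := he.comp _ (add_left_injective 1)
    have h1 : ‖S z‖ ^ 2 = ∑ i ∈ Finset.range m, ‖(inner ℂ (e i) z : ℂ)‖ ^ 2 := by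
      have := he1.inner_sum (fun i => (inner ℂ (e i) z : ℂ)) (fun i => (inner ℂ (e i) z : ℂ)) (Finset.range m)
      rw [← hS, inner_self_eq_norm_sq_to_K] at this
      have h2 : ((‖S z‖ ^ 2 : ℝ) : ℂ) = ((∑ i ∈ Finset.range m, ‖(inner ℂ (e i) z : ℂ)‖ ^ 2 : ℝ) : ℂ) := by
        push_cast
        refine this.trans (Finset.sum_congr rfl fun i _ => ?_)
        rw [RCLike.conj_mul]; rfl
      exact_mod_cast h2
    have h3 : ∀ i, (inner ℂ (e i) z : ℂ) = inner ℂ (e i) (Vᗮ.starProjection z) := by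
      intro i
      rw [← Submodule.inner_starProjection_left_eq_right, Submodule.starProjection_eq_self_iff.2 (heV i)]
    rw [h1]
    simp_rw [h3]
    exact he.sum_inner_products_le _
  let L : H →L[ℂ] H := B + (w : ℂ) • S
  have hL : ‖L‖ ≤ w := by
    refine ContinuousLinearMap.opNorm_le_bound _ hw fun z => ?_
    have hSV : S z ∈ Vᗮ := by
      rw [hS]; exact Submodule.sum_mem _ fun i _ => Submodule.smul_mem _ _ (heV _)
    have h0 : inner ℂ (B z) ((w : ℂ) • S z) = (0:ℂ) := by
      rw [inner_smul_right, (Submodule.mem_orthogonal V _).1 hSV _ (hBV z), mul_zero]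
    have h1 := norm_add_sq_eq_norm_sq_add_norm_sq_of_inner_eq_zero (𝕜 := ℂ) (B z) ((w : ℂ) • S z) h0
    have h2 : ‖B z‖ ≤ w * ‖V.starProjection z‖ := by
      rw [← hBP]; exact B.le_of_opNorm_le hB _
    have h3 := Submodule.norm_sq_eq_add_norm_sq_starProjection z V
    have h4 : ‖(w : ℂ) • S z‖ = w * ‖S z‖ := by
      rw [norm_smul]; simp [abs_of_nonneg hw]
    rw [h4] at h1
    have h5 : ‖L z‖ ^ 2 ≤ (w * ‖z‖) ^ 2 := by
      have h6 : ‖B z‖ ^ 2 ≤ (w * ‖V.starProjection z‖) ^ 2 := by gcongr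
      have h7 := mul_le_mul_of_nonneg_left (hSn z) (sq_nonneg w)
      have h8 : ‖L z‖ * ‖L z‖ = ‖B z‖ * ‖B z‖ + w * ‖S z‖ * (w * ‖S z‖) := h1
      rw [mul_pow, h3]
      nlinarith
    exact le_of_sq_le_sq h5 (by positivity)
  let Q : H →L[ℂ] H := (innerSL ℂ (e m)).smulRight v
  have hQ : ‖Q‖ ≤ ‖v‖ := by
    have : ‖Q‖ = ‖e m‖ * ‖v‖ := by simp [Q, ContinuousLinearMap.norm_smulRight_apply]
    rw [this, he.1 m, one_mul]
  have hT : ∀ z, (L + Q) z = B z + (w:ℂ) • S z + (inner ℂ (e m) z : ℂ) • v := fun z => by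
    simp [L, Q]
  have hBe : ∀ i, B (e i) = 0 := fun i => by
    rw [← hBP, (Submodule.starProjection_apply_eq_zero_iff V).2 (heV i), map_zero]
  have hTe : ∀ k, k ≤ m → ((L + Q) ^ k) (e 0) = ((w:ℂ) ^ k) • e k := by
    intro k
    induction k with
    | zero => simp
    | succ k ih =>
      intro hk
      have hkm : k ≠ m := by omega
      rw [pow_succ', mul_apply_eq_comp, ih (by omega), map_smul, hT, hBe, hS]
      simp only [hee, ite_smul, one_smul, zero_smul]
      rw [Finset.sum_ite_eq' (Finset.range m) k, if_pos (Finset.mem_range.2 (by omega)), if_neg (Ne.symm hkm)]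
      rw [zero_add, add_zero, smul_smul, pow_succ]
  refine ⟨e 0, he.1 0, heV 0, L + Q, (norm_add_le _ _).trans (add_le_add hL hQ), ?_, ?_⟩
  · intro z hz
    rw [hT, hS]
    simp [heV0 _ z hz]
  · rw [pow_succ', mul_apply_eq_comp, hTe m le_rfl, map_smul, hT, hBe, hS]
    simp only [hee, ite_smul, one_smul, zero_smul]
    rw [Finset.sum_ite_eq' (Finset.range m) m, if_neg (by simp)]
    simp

theorem params {R : ℝ} (hR : 0 < R) (M ε δ Y X : ℝ) (hM : 0 ≤ M) (hε : 0 < ε) (hδ : 0 < δ)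
    (hX : 0 < X) (hY : 0 ≤ Y) :
    ∃ c w ν η : ℝ, ∃ m : ℕ, 0 < c ∧ c < 1 ∧ c * R ≤ w ∧ 0 < w ∧ 0 < ν ∧ 0 < η ∧
      (1 + ν) * (w + η * Y) * (1 + ν) ≤ R ∧
      (2 * ν + ν ^ 2) * R * M + (1 - c) * R * M < ε ∧
      (1 + ν) * ((ν * X * w ^ m * η)⁻¹ * ((c * R) ^ (m + 1) * X)) + ν * Y < δ := by
  obtain ⟨c, hc0, hc1, hc⟩ : ∃ c : ℝ, 0 < c ∧ c < 1 ∧ (1 - c) * R * M < ε := by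
    have h1 : ∀ᶠ c : ℝ in 𝓝[<] 1, (1 - c) * R * M < ε := by
      apply Filter.Eventually.filter_mono nhdsWithin_le_nhds
      apply ContinuousAt.eventually_lt (by fun_prop) (by fun_prop)
      simpa using hε
    have h2 : ∀ᶠ c : ℝ in 𝓝[<] 1, 0 < c :=
      Filter.Eventually.filter_mono nhdsWithin_le_nhds (lt_mem_nhds one_pos)
    obtain ⟨c, h1, h2, h3⟩ := (h1.and (h2.and self_mem_nhdsWithin)).exists
    exact ⟨c, h2, h3, h1⟩
  obtain ⟨w, hw1, hw2⟩ : ∃ w, c * R < w ∧ w < R := exists_between (by nlinarith)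
  have hcR : 0 < c * R := by positivity
  have hw0 : 0 < w := hcR.trans hw1
  obtain ⟨ν, hν0, hν1, hν2, hν3⟩ : ∃ ν : ℝ, 0 < ν ∧ (1 + ν) * w * (1 + ν) < R ∧
      (2 * ν + ν ^ 2) * R * M + (1 - c) * R * M < ε ∧ ν * Y < δ := by
    have h1 : ∀ᶠ ν : ℝ in 𝓝[>] 0, (1 + ν) * w * (1 + ν) < R := by
      apply Filter.Eventually.filter_mono nhdsWithin_le_nhds
      apply ContinuousAt.eventually_lt (by fun_prop) (by fun_prop)
      simpa using hw2
    have h2 : ∀ᶠ ν : ℝ in 𝓝[>] 0, (2 * ν + ν ^ 2) * R * M + (1 - c) * R * M < ε := by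
      apply Filter.Eventually.filter_mono nhdsWithin_le_nhds
      apply ContinuousAt.eventually_lt (by fun_prop) (by fun_prop)
      simpa using hc
    have h3 : ∀ᶠ ν : ℝ in 𝓝[>] 0, ν * Y < δ := by
      apply Filter.Eventually.filter_mono nhdsWithin_le_nhds
      apply ContinuousAt.eventually_lt (by fun_prop) (by fun_prop)
      simpa using hδ
    obtain ⟨ν, h1, h2, h3, h4⟩ := (h1.and (h2.and (h3.and self_mem_nhdsWithin))).exists
    exact ⟨ν, h4, h1, h2, h3⟩
  obtain ⟨η, hη0, hη⟩ : ∃ η : ℝ, 0 < η ∧ (1 + ν) * (w + η * Y) * (1 + ν) < R := by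
    have h1 : ∀ᶠ η : ℝ in 𝓝[>] 0, (1 + ν) * (w + η * Y) * (1 + ν) < R := by
      apply Filter.Eventually.filter_mono nhdsWithin_le_nhds
      apply ContinuousAt.eventually_lt (by fun_prop) (by fun_prop)
      simpa using hν1
    obtain ⟨η, h1, h2⟩ := (h1.and self_mem_nhdsWithin).exists
    exact ⟨η, h2, h1⟩
  obtain ⟨m, hm⟩ : ∃ m : ℕ,
      (1 + ν) * ((ν * X * w ^ m * η)⁻¹ * ((c * R) ^ (m + 1) * X)) + ν * Y < δ := by
    have h1 : Tendsto (fun m : ℕ => (1 + ν) * (c * R) / (ν * η) * (c * R / w) ^ m + ν * Y) atTop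
        (𝓝 ((1 + ν) * (c * R) / (ν * η) * 0 + ν * Y)) := by
      apply Tendsto.add_const
      apply Tendsto.const_mul
      apply tendsto_pow_atTop_nhds_zero_of_lt_one (by positivity)
      rwa [div_lt_one hw0]
    rw [mul_zero, zero_add] at h1
    obtain ⟨m, hm⟩ := (h1.eventually (gt_mem_nhds hν3)).exists
    refine ⟨m, lt_of_eq_of_lt ?_ hm⟩
    congr 1
    rw [div_pow]
    field_simp
    ring
  exact ⟨c, w, ν, η, m, hc0, hc1, hw1.le, hw0, hν0, hη0, hη.le, hν2, hm⟩

theorem core {H : Type*} [NormedAddCommGroup H] [InnerProductSpace ℂ H]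
    (hinf : ¬ FiniteDimensional ℂ H) {R : ℝ} (hR : 0 < R) (T0 : H →L[ℂ] H) (hT0 : ‖T0‖ ≤ R)
    (F : Finset H) {ε : ℝ} (hε : 0 < ε) {x : H} (hx : x ≠ 0) (y : H) {δ : ℝ} (hδ : 0 < δ) :
    ∃ T : H →L[ℂ] H, ‖T‖ ≤ R ∧ (∀ z ∈ F, ‖T z - T0 z‖ < ε) ∧
      ∃ (a : ℂ) (n : ℕ), ‖a • (T ^ n) x - y‖ < δ := by
  classical
  have hX : 0 < ‖x‖ := norm_pos_iff.2 hx
  have hMz : ∀ z ∈ F, ‖z‖ ≤ ∑ z ∈ F, ‖z‖ := fun z hz =>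
    Finset.single_le_sum (f := fun z : H => ‖z‖) (fun i _ => norm_nonneg i) hz
  obtain ⟨c, w, ν, η, m, hc0, hc1, hcw, hw0, hν0, hη0, hη, hε', hδ'⟩ :=
    params hR (∑ z ∈ F, ‖z‖) ε δ ‖y‖ ‖x‖ (Finset.sum_nonneg fun i _ => norm_nonneg i) hε hδ hX
      (norm_nonneg y)
  let G : Finset H := insert x (F ∪ F.image T0)
  let V : Submodule ℂ H := Submodule.span ℂ (G : Set H)
  have : FiniteDimensional ℂ V := FiniteDimensional.span_finset ℂ G
  have hxV : x ∈ V := Submodule.subset_span (by simp [G])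
  have hFV : ∀ z ∈ F, z ∈ V := fun z hz => Submodule.subset_span (by simp [G, hz])
  have hTV : ∀ z ∈ F, T0 z ∈ V := fun z hz =>
    Submodule.subset_span (Finset.mem_coe.2 (Finset.mem_insert_of_mem
      (Finset.mem_union_right _ (Finset.mem_image_of_mem _ hz))))
  let B : H →L[ℂ] H := (c : ℂ) • (V.starProjection ∘L T0 ∘L V.starProjection)
  have hBa : ∀ z, B z = (c : ℂ) • V.starProjection (T0 (V.starProjection z)) := fun z => rfl
  have hBn : ‖B‖ ≤ c * R := by
    refine ContinuousLinearMap.opNorm_le_bound _ (by positivity) fun z => ?_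
    rw [hBa, norm_smul, Complex.norm_real, Real.norm_of_nonneg hc0.le, mul_assoc]
    gcongr
    refine (Submodule.norm_starProjection_apply_le _ _).trans ?_
    refine (T0.le_of_opNorm_le hT0 _).trans ?_
    gcongr
    exact Submodule.norm_starProjection_apply_le _ _
  have hBV : ∀ z, B z ∈ V := fun z => V.smul_mem _ (V.starProjection_apply_mem _)
  have hBP : ∀ z, B (V.starProjection z) = B z := fun z => by
    rw [hBa, hBa, Submodule.starProjection_eq_self_iff.2 (V.starProjection_apply_mem z)]
  obtain ⟨e, he1, heV, T, hTn, hTB, hTe⟩ := op_exists hinf V B hBV hBP w hw0.le (hBn.trans hcw)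
    ((η : ℂ) • y) m
  have hηy : ‖(η : ℂ) • y‖ = η * ‖y‖ := by
    rw [norm_smul, Complex.norm_real, Real.norm_of_nonneg hη0.le]
  rw [hηy] at hTn
  let N : H →L[ℂ] H := (innerSL ℂ x).smulRight (((ν / ‖x‖ : ℝ) : ℂ) • e)
  have hNa : ∀ z, N z = (inner ℂ x z : ℂ) • ((ν / ‖x‖ : ℝ) : ℂ) • e := fun z => by simp [N]
  have hNn : ‖N‖ ≤ ν := by
    have : ‖N‖ = ‖x‖ * ‖((ν / ‖x‖ : ℝ) : ℂ) • e‖ := by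
      simp only [N, ContinuousLinearMap.norm_smulRight_apply, innerSL_apply_norm]
    rw [this, norm_smul, Complex.norm_real, Real.norm_of_nonneg (by positivity), he1, mul_one]
    apply le_of_eq
    field_simp
  have hNe : N e = 0 := by
    rw [hNa, (Submodule.mem_orthogonal V _).1 heV x hxV, zero_smul]
  have hNN : N * N = 0 := by
    ext z
    rw [mul_apply_eq_comp, hNa z, map_smul, map_smul, hNe]; simp
  have hNx : N x = ((ν * ‖x‖ : ℝ) : ℂ) • e := by
    rw [hNa, inner_self_eq_norm_sq_to_K, smul_smul]
    congr 1
    have : ((‖x‖ : ℝ) : ℂ) ≠ 0 := by exact_mod_cast hX.ne'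
    push_cast
    field_simp
    exact mul_comm _ _
  have hinv : (1 + N) * (1 - N) = 1 := by
    have : (1 + N) * (1 - N) = 1 - N * N := by noncomm_ring
    rw [this, hNN, sub_zero]
  have h1 : ‖(1 : H →L[ℂ] H)‖ ≤ 1 := ContinuousLinearMap.norm_id_le
  have hp : ‖1 + N‖ ≤ 1 + ν := (norm_add_le _ _).trans (add_le_add h1 hNn)
  have hm : ‖1 - N‖ ≤ 1 + ν := (norm_sub_le _ _).trans (add_le_add h1 hNn)
  have hTR : ‖T‖ ≤ R := by
    refine hTn.trans (le_trans ?_ hη)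
    have : 0 ≤ w + η * ‖y‖ := by positivity
    nlinarith [mul_nonneg hν0.le this, mul_nonneg (mul_nonneg hν0.le this) hν0.le]
  have hpow : ∀ k, ((1 - N) * T * (1 + N)) ^ k = (1 - N) * T ^ k * (1 + N) := by
    intro k
    induction k with
    | zero =>
      have : (1 - N) * (1 + N) = 1 - N * N := by noncomm_ring
      rw [pow_zero, pow_zero, mul_one, this, hNN, sub_zero]
    | succ k ih =>
      rw [pow_succ, ih, pow_succ]
      calc (1 - N) * T ^ k * (1 + N) * ((1 - N) * T * (1 + N))
          = (1 - N) * T ^ k * ((1 + N) * (1 - N)) * T * (1 + N) := by simp only [mul_assoc]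
        _ = _ := by rw [hinv, mul_one]; simp only [mul_assoc]
  have hTx : ∀ k, (T ^ k) x ∈ V ∧ ‖(T ^ k) x‖ ≤ (c * R) ^ k * ‖x‖ := by
    intro k
    induction k with
    | zero => simpa using hxV
    | succ k ih =>
      rw [pow_succ', mul_apply_eq_comp, hTB _ ih.1]
      refine ⟨hBV _, (B.le_of_opNorm_le hBn _).trans ?_⟩
      rw [pow_succ', mul_assoc (c * R)]
      exact mul_le_mul_of_nonneg_left ih.2 (by positivity)
  refine ⟨(1 - N) * T * (1 + N), ?_, ?_, (((ν * ‖x‖ * w ^ m * η)⁻¹ : ℝ) : ℂ), m + 1, ?_⟩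
  · refine le_trans ?_ hη
    refine (norm_mul_le _ _).trans ?_
    gcongr
    refine (norm_mul_le _ _).trans ?_
    gcongr
  · intro z hz
    have hTz : T z = (c : ℂ) • T0 z := by
      rw [hTB z (hFV z hz), hBa, Submodule.starProjection_eq_self_iff.2 (hFV z hz),
        Submodule.starProjection_eq_self_iff.2 (hTV z hz)]
    have hd : ((1 - N) * T * (1 + N)) z - T0 z
        = (T * N - N * T - N * T * N) z - ((1 - c : ℝ) : ℂ) • T0 z := by
      have : (1 - N) * T * (1 + N) = T + (T * N - N * T - N * T * N) := by noncomm_ring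
      rw [this, add_apply, hTz]
      push_cast
      module
    have hdn : ‖T * N - N * T - N * T * N‖ ≤ (2 * ν + ν ^ 2) * R := by
      have a1 : ‖T * N‖ ≤ R * ν := (norm_mul_le _ _).trans (by gcongr)
      have a2 : ‖N * T‖ ≤ ν * R := (norm_mul_le _ _).trans (by gcongr)
      have a3 : ‖N * T * N‖ ≤ ν * R * ν := (norm_mul_le _ _).trans (by gcongr)
      have a4 := norm_sub_le (T * N - N * T) (N * T * N)
      have a5 := norm_sub_le (T * N) (N * T)
      nlinarith
    rw [hd]
    refine lt_of_le_of_lt (norm_sub_le _ _) (lt_of_le_of_lt ?_ hε')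
    have hc' : 0 ≤ 1 - c := by linarith
    rw [norm_smul, Complex.norm_real, Real.norm_of_nonneg hc', mul_assoc (1 - c)]
    gcongr
    · refine (ContinuousLinearMap.le_of_opNorm_le _ hdn z).trans ?_
      gcongr
      exact hMz z hz
    · refine (T0.le_of_opNorm_le hT0 z).trans ?_
      gcongr
      exact hMz z hz
  · set a : ℝ := (ν * ‖x‖ * w ^ m * η)⁻¹ with ha
    have ha0 : 0 < a := by positivity
    have hay : ((a : ℝ) : ℂ) • (T ^ (m + 1)) (N x) = y := by
      rw [hNx, map_smul, hTe, smul_smul, smul_smul, smul_smul]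
      have : (a : ℂ) * ((ν * ‖x‖ : ℝ) : ℂ) * (w : ℂ) ^ m * (η : ℂ) = 1 := by
        have h : a * (ν * ‖x‖) * w ^ m * η = 1 := by
          rw [ha]; field_simp
        exact_mod_cast h
      rw [this, one_smul]
    have hfin : (a : ℂ) • (((1 - N) * T * (1 + N)) ^ (m + 1)) x - y
        = (1 - N) ((a : ℂ) • (T ^ (m + 1)) x) - N y := by
      have : (a : ℂ) • (((1 - N) * T * (1 + N)) ^ (m + 1)) x
          = (1 - N) ((a : ℂ) • (T ^ (m + 1)) x + (a : ℂ) • (T ^ (m + 1)) (N x)) := by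
        rw [hpow, mul_apply_eq_comp, mul_apply_eq_comp, ← smul_add, ← map_add, map_smul]
        rfl
      rw [this, hay, map_add]
      simp only [sub_apply, one_apply_eq_self]
      abel
    rw [hfin]
    refine lt_of_le_of_lt (norm_sub_le _ _) (lt_of_le_of_lt ?_ hδ')
    gcongr
    · refine (ContinuousLinearMap.le_of_opNorm_le _ hm _).trans ?_
      rw [norm_smul, Complex.norm_real, Real.norm_of_nonneg ha0.le]
      gcongr
      exact (hTx (m + 1)).2
    · exact N.le_of_opNorm_le hNn y

/-- The closed ball of operators, as a type carrying only the strong operator topology. -/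
def SB (R : ℝ) (H : Type*) [NormedAddCommGroup H] [InnerProductSpace ℂ H] :=
  {T : H →L[ℂ] H // ‖T‖ ≤ R}

instance instSB (R : ℝ) (H : Type*) [NormedAddCommGroup H] [InnerProductSpace ℂ H] :
    TopologicalSpace (SB R H) := SOTball R H

section

variable {H : Type*} [NormedAddCommGroup H] [InnerProductSpace ℂ H] {R : ℝ}

theorem SB_inducing : IsInducing (fun (T : SB R H) (x : H) => T.1 x) := ⟨rfl⟩

theorem SB_eval (x : H) : Continuous (fun T : SB R H => T.1 x) :=
  (continuous_apply x).comp SB_inducing.continuous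

theorem SB_dist (hR : 0 < R) (T : SB R H) (x y : H) : dist (T.1 x) (T.1 y) ≤ R * dist x y := by
  rw [dist_eq_norm, dist_eq_norm, ← map_sub]
  exact T.1.le_of_opNorm_le T.2 _

theorem SB_pow (hR : 0 < R) (x : H) (n : ℕ) : Continuous (fun T : SB R H => (T.1 ^ n) x) := by
  induction n with
  | zero => simpa using continuous_const
  | succ n ih =>
    simp only [pow_succ', mul_apply_eq_comp]
    rw [continuous_iff_continuousAt]
    intro T
    have h1 : Tendsto (fun S : SB R H => R * dist ((S.1 ^ n) x) ((T.1 ^ n) x)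
        + dist (S.1 ((T.1 ^ n) x)) (T.1 ((T.1 ^ n) x))) (𝓝 T) (𝓝 (R * 0 + 0)) :=
      ((tendsto_iff_dist_tendsto_zero.1 ih.continuousAt).const_mul R).add
        (tendsto_iff_dist_tendsto_zero.1 (SB_eval _).continuousAt)
    rw [mul_zero, add_zero] at h1
    refine tendsto_iff_dist_tendsto_zero.2 (squeeze_zero (fun _ => dist_nonneg) (fun S => ?_) h1)
    refine (dist_triangle _ (S.1 ((T.1 ^ n) x)) _).trans ?_
    gcongr
    exact SB_dist hR S _ _

theorem SB_inducing' (hR : 0 < R) {D : Set H} (hD : Dense D) :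
    IsInducing (fun (T : SB R H) (x : D) => T.1 (x : H)) := by
  refine ⟨le_antisymm (continuous_iff_le_induced.1 (continuous_pi fun x => SB_eval _)) ?_⟩
  letI t' : TopologicalSpace {T : H →L[ℂ] H // ‖T‖ ≤ R} :=
    TopologicalSpace.induced (fun T (x : D) => T.1 (x : H)) Pi.topologicalSpace
  have hc : Continuous (fun (T : {T : H →L[ℂ] H // ‖T‖ ≤ R}) (x : D) => T.1 (x : H)) :=
    continuous_induced_dom
  have : Continuous (fun (T : {T : H →L[ℂ] H // ‖T‖ ≤ R}) (x : H) => T.1 x) := by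
    refine continuous_pi fun x => continuous_of_uniform_approx_of_continuous fun u hu => ?_
    obtain ⟨ε, hε, hu⟩ := Metric.mem_uniformity_dist.1 hu
    obtain ⟨d, hd, hxd⟩ := hD.exists_dist_lt x (div_pos hε hR)
    refine ⟨fun T => T.1 d, (continuous_apply (⟨d, hd⟩ : D)).comp hc, fun T => hu ?_⟩
    refine (SB_dist hR T _ _).trans_lt ?_
    rwa [lt_div_iff₀ hR, mul_comm] at hxd
  exact continuous_iff_le_induced.1 this

theorem SB_closed [CompleteSpace H] (hR : 0 < R) {D : Set H} (hDc : D.Countable) (hD : Dense D) :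
    IsClosedEmbedding (fun (T : SB R H) (x : D) => T.1 (x : H)) := by
  haveI : Countable D := hDc.to_subtype
  refine ⟨⟨SB_inducing' hR hD, ?_⟩, ?_⟩
  · intro S T h
    apply Subtype.ext
    apply ContinuousLinearMap.ext
    intro x
    exact congrFun (Continuous.ext_on hD S.1.continuous T.1.continuous
      fun d hd => congrFun h (⟨d, hd⟩ : D)) x
  · apply IsSeqClosed.isClosed
    intro u f hu hf
    choose T hT using hu
    rw [tendsto_pi_nhds] at hf
    have hlim : ∀ x, ∃ y, Tendsto (fun n => (T n).1 x) atTop (𝓝 y) := by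
      intro x
      apply cauchySeq_tendsto_of_complete
      rw [Metric.cauchySeq_iff]
      intro ε hε
      obtain ⟨d, hd, hxd⟩ := hD.exists_dist_lt x (div_pos (div_pos hε three_pos) hR)
      have hc : CauchySeq (fun n => (T n).1 d) := by
        have := (hf ⟨d, hd⟩).cauchySeq
        simpa only [← hT] using this
      obtain ⟨N, hN⟩ := Metric.cauchySeq_iff.1 hc (ε / 3) (by positivity)
      refine ⟨N, fun m hm n hn => ?_⟩
      have h1 := SB_dist hR (T m) x d
      have h2 := SB_dist hR (T n) d x
      have h3 := hN m hm n hn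
      have h4 := dist_triangle4 ((T m).1 x) ((T m).1 d) ((T n).1 d) ((T n).1 x)
      rw [lt_div_iff₀ hR] at hxd
      rw [dist_comm d x] at h2
      linarith
    choose g hg using hlim
    let G := continuousLinearMapOfTendsto (fun n => (T n).1) (tendsto_pi_nhds.2 hg)
    have hG : ∀ x, G x = g x := fun x => rfl
    have hGR : ‖G‖ ≤ R := by
      refine ContinuousLinearMap.opNorm_le_bound _ hR.le fun x => ?_
      exact le_of_tendsto (hg x).norm
        (Eventually.of_forall fun n => (T n).1.le_of_opNorm_le (T n).2 x)
    refine ⟨⟨G, hGR⟩, funext fun d => ?_⟩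
    refine tendsto_nhds_unique (hg d) ?_
    have := hf d
    simpa only [← hT] using this

theorem SB_baire [CompleteSpace H] (hR : 0 < R) {D : Set H} (hDc : D.Countable) (hD : Dense D) :
    BaireSpace (SB R H) := by
  haveI : Countable D := hDc.to_subtype
  haveI := (SB_closed hR hDc hD).IsCompletelyMetrizableSpace
  infer_instance

/-- Operators for which the projective orbit of `x` comes close to `y`. -/
def hitSet (R : ℝ) {H : Type*} [NormedAddCommGroup H] [InnerProductSpace ℂ H] (x y : H) (δ : ℝ) :
    Set (SB R H) := {T | ∃ (a : ℂ) (n : ℕ), ‖a • (T.1 ^ n) x - y‖ < δ}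

theorem hitSet_open (hR : 0 < R) (x y : H) (δ : ℝ) : IsOpen (hitSet R x y δ) := by
  have : hitSet R x y δ = ⋃ (a : ℂ) (n : ℕ), {T | ‖a • (T.1 ^ n) x - y‖ < δ} := by
    ext T; simp [hitSet]
  rw [this]
  refine isOpen_iUnion fun a => isOpen_iUnion fun n => ?_
  exact isOpen_lt (((SB_pow hR x n).const_smul a).sub continuous_const).norm continuous_const

theorem hitSet_dense (hinf : ¬ FiniteDimensional ℂ H) (hR : 0 < R) {x : H} (hx : x ≠ 0) (y : H)
    {δ : ℝ} (hδ : 0 < δ) : Dense (hitSet R x y δ) := by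
  intro T0
  rw [mem_closure_iff]
  intro o ho hT0
  obtain ⟨o', ho', rfl⟩ := SB_inducing.isOpen_iff.1 ho
  obtain ⟨I, u, hu, hsub⟩ := isOpen_pi_iff.1 ho' _ hT0
  have h1 : ∀ᶠ ε : ℝ in 𝓝[>] 0, ∀ z ∈ I, Metric.ball (T0.1 z) ε ⊆ u z := by
    rw [eventually_all_finset]
    intro z hz
    obtain ⟨r, hr, hb⟩ := Metric.isOpen_iff.1 (hu z hz).1 _ (hu z hz).2
    filter_upwards [Ioo_mem_nhdsGT hr] with ε hε
    exact (Metric.ball_subset_ball hε.2.le).trans hb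
  obtain ⟨ε, h1, hε⟩ := (h1.and self_mem_nhdsWithin).exists
  obtain ⟨T, hT, hTI, a, n, han⟩ := core hinf hR T0.1 T0.2 I hε hx y hδ
  refine ⟨⟨T, hT⟩, hsub fun z hz => h1 z hz ?_, a, n, han⟩
  rw [Metric.mem_ball, dist_eq_norm]
  exact hTI z hz

theorem SB_main [CompleteSpace H] (hinf : ¬ FiniteDimensional ℂ H)
    (D : Set H) (hDc : D.Countable) (hDd : Dense D) (hD0 : 0 ∉ D) (hR : 0 < R) :
    Dense {T : SB R H | ∀ x ∈ D, Dense (Set.range fun p : ℂ × ℕ => p.1 • (T.1 ^ p.2) x)} ∧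
    IsGδ {T : SB R H | ∀ x ∈ D, Dense (Set.range fun p : ℂ × ℕ => p.1 • (T.1 ^ p.2) x)} := by
  haveI := SB_baire (R := R) hR hDc hDd
  let P : Set ((H × H) × ℕ) := (D ×ˢ D) ×ˢ Set.univ
  have hP : P.Countable := (hDc.prod hDc).prod Set.countable_univ
  have hk : ∀ k : ℕ, (0 : ℝ) < 1 / ((k : ℝ) + 1) := fun k => Nat.one_div_pos_of_nat
  have hset : {T : SB R H | ∀ x ∈ D, Dense (Set.range fun p : ℂ × ℕ => p.1 • (T.1 ^ p.2) x)}
      = ⋂ p ∈ P, hitSet R p.1.1 p.1.2 (1 / ((p.2 : ℝ) + 1)) := by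
    ext T
    simp only [Set.mem_setOf_eq, Set.mem_iInter]
    constructor
    · rintro h ⟨⟨x, y⟩, k⟩ hp
      obtain ⟨_, ⟨⟨a, n⟩, rfl⟩, hd⟩ := (h x hp.1.1).exists_dist_lt y (hk k)
      refine ⟨a, n, ?_⟩
      rwa [dist_comm, dist_eq_norm] at hd
    · intro h x hx
      rw [Metric.dense_iff]
      intro z r hr
      obtain ⟨y, hy, hzy⟩ := hDd.exists_dist_lt z (half_pos hr)
      obtain ⟨k, hkr⟩ := exists_nat_one_div_lt (half_pos hr)
      obtain ⟨a, n, han⟩ := h ((x, y), k) ⟨⟨hx, hy⟩, trivial⟩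
      refine ⟨a • (T.1 ^ n) x, ?_, ⟨(a, n), rfl⟩⟩
      rw [Metric.mem_ball]
      have h2 := dist_triangle (a • (T.1 ^ n) x) y z
      rw [dist_eq_norm _ y, dist_comm y z] at h2
      have h3 : ‖a • (T.1 ^ n) x - y‖ < r / 2 := han.trans hkr
      linarith
  rw [hset]
  constructor
  · refine dense_biInter_of_isOpen (fun p _ => hitSet_open hR _ _ _) hP fun p hp => ?_
    exact hitSet_dense hinf hR (fun h0 => hD0 (h0 ▸ hp.1.1)) _ (hk _)
  · exact IsGδ.biInter_of_isOpen hP fun p _ => hitSet_open hR _ _ _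

end

/-- For `R > 0` and a countable dense set `D` of nonzero vectors, the set of operators in
`B_R` for which every `x ∈ D` is supercyclic is dense Gδ in the strong operator topology. -/
theorem stmt13 {H : Type*} [NormedAddCommGroup H] [InnerProductSpace ℂ H] [CompleteSpace H]
    [TopologicalSpace.SeparableSpace H] (hinf : ¬ FiniteDimensional ℂ H)
    (D : Set H) (hDc : D.Countable) (hDd : Dense D) (hD0 : 0 ∉ D)
    (R : ℝ) (hR : 0 < R) :
    @Dense _ (SOTball R H)
      {T : {T : H →L[ℂ] H // ‖T‖ ≤ R} |
        ∀ x ∈ D, Dense (Set.range fun p : ℂ × ℕ => p.1 • (T.1 ^ p.2) x)} ∧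
    @IsGδ _ (SOTball R H)
      {T : {T : H →L[ℂ] H // ‖T‖ ≤ R} |
        ∀ x ∈ D, Dense (Set.range fun p : ℂ × ℕ => p.1 • (T.1 ^ p.2) x)} := by
  exact SB_main hinf D hDc hDd hD0 hR
end
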